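/- If u and v are conjugate elements of the surface group G, then there exist irreducible words X and Y and words A₁, A₂ in the alphabet S± such that both A₁A₂ and A₂A₁ are cyclically irreducible, u is represented by the word X⁻¹A₂A₁X, v is represented by the word Y⁻¹A₁A₂Y, and both of the words X⁻¹A₂A₁X and Y⁻¹A₁A₂Y are freely reduced. -/

import Mathlib

namespace SG

/-- A letter of the alphabet `S± = {cᵢ^{±1}}`: `(i, true)` is `c_{i+1}`,
`(i, false)` is `c_{i+1}⁻¹`. -/
abbrev Letter (g : ℕ) := Fin (2*g) × Bool

/-- A word in the alphabet `S±`. -/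
abbrev Word (g : ℕ) := List (Letter g)

/-- The surface relator `c₁c₂⋯c_{2g}c₁⁻¹c₂⁻¹⋯c_{2g}⁻¹` in the free group. -/
def relator (g : ℕ) : FreeGroup (Fin (2*g)) :=
  (List.ofFn fun i : Fin (2*g) => FreeGroup.of i).prod *
  (List.ofFn fun i : Fin (2*g) => (FreeGroup.of i)⁻¹).prod

/-- The surface group with the symmetric presentation. -/
abbrev SurfaceGroup (g : ℕ) :=
  PresentedGroup ({relator g} : Set (FreeGroup (Fin (2*g))))

/-- The generator `c_{i+1}` of the surface group. -/
def gen (g : ℕ) (i : Fin (2*g)) : SurfaceGroup g := PresentedGroup.of i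

/-- The inverse of a letter. -/
def invLetter (g : ℕ) (a : Letter g) : Letter g := (a.1, !a.2)

/-- The group element represented by a letter. -/
def evalLetter (g : ℕ) (a : Letter g) : SurfaceGroup g :=
  if a.2 then gen g a.1 else (gen g a.1)⁻¹

/-- The group element represented by a word. -/
def eval (g : ℕ) (W : Word g) : SurfaceGroup g := (W.map (evalLetter g)).prod

/-- The formal inverse `x_n⁻¹ ⋯ x₁⁻¹` of a word `x₁ ⋯ x_n`. -/
def wordInv (g : ℕ) (W : Word g) : Word g := (W.map (invLetter g)).reverse

/-- Word length of a group element: the least `n` such that the element is a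
product of `n` elements of `S ∪ S⁻¹`. -/
noncomputable def len (g : ℕ) (u : SurfaceGroup g) : ℕ :=
  sInf {n | ∃ W : Word g, W.length = n ∧ eval g W = u}

/-- `conjLen g u v` is the minimum of `|x|` over conjugators `x` with `x⁻¹ux = v`. -/
noncomputable def conjLen (g : ℕ) (u v : SurfaceGroup g) : ℕ :=
  sInf {k | ∃ x : SurfaceGroup g, x⁻¹ * u * x = v ∧ len g x = k}

/-- The conjugator length function: `CL g n` is the least `N` such that any
conjugate `u, v` with `|u| + |v| ≤ n` admit a conjugator of length `≤ N`. -/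
noncomputable def CL (g : ℕ) (n : ℕ) : ℕ :=
  sInf {N | ∀ u v : SurfaceGroup g,
    (∃ x : SurfaceGroup g, x⁻¹ * u * x = v) → len g u + len g v ≤ n →
      conjLen g u v ≤ N}

/-- Rank of a letter in the ascending order
`c_{2g} ≺ ⋯ ≺ c₂ ≺ c₁ ≺ c₁⁻¹ ≺ c₂⁻¹ ≺ ⋯ ≺ c_{2g}⁻¹`. -/
def rank (g : ℕ) (a : Letter g) : ℕ :=
  if a.2 then (2*g - 1) - (a.1 : ℕ) else 2*g + (a.1 : ℕ)

/-- The strict order `≺` on letters. -/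
def letterLt (g : ℕ) (a b : Letter g) : Prop := rank g a < rank g b

/-- The length-lexicographical order `≺` on words. -/
def wordLt (g : ℕ) (X Y : Word g) : Prop :=
  X.length < Y.length ∨ (X.length = Y.length ∧ List.Lex (letterLt g) X Y)

/-- A word is irreducible if it is the `≺`-least word representing its element. -/
def IrreducibleWord (g : ℕ) (W : Word g) : Prop :=
  ∀ W' : Word g, eval g W' = eval g W → W' = W ∨ wordLt g W W'

/-- A word is cyclically irreducible if all its cyclic permutations are irreducible. -/
def CyclicallyIrreducibleWord (g : ℕ) (W : Word g) : Prop :=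
  ∀ W' : Word g, List.IsRotated W W' → IrreducibleWord g W'

/-- A word is freely reduced if no letter is followed by its inverse. -/
def FreelyReduced (g : ℕ) (W : Word g) : Prop :=
  List.Chain' (fun a c => c ≠ invLetter g a) W

/-- The normal form of a group element: the `≺`-least word representing it. -/
noncomputable def nf (g : ℕ) (x : SurfaceGroup g) : Word g := by
  classical
  exact if h : ∃ W : Word g, eval g W = x ∧ IrreducibleWord g W then h.choose else []

/-- The word `R = c₁c₂⋯c_{2g}c₁⁻¹c₂⁻¹⋯c_{2g}⁻¹`. -/
def Rword (g : ℕ) : Word g :=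
  (List.ofFn fun i : Fin (2*g) => ((i, true) : Letter g)) ++
  (List.ofFn fun i : Fin (2*g) => ((i, false) : Letter g))

/-- `𝓡`: all cyclic permutations of `R` and of `R⁻¹`. -/
def RSet (g : ℕ) : Set (Word g) :=
  {W | List.IsRotated (Rword g) W ∨ List.IsRotated (wordInv g (Rword g)) W}

/-- `seg g b i k` is the word `b_i b_{i+1} ⋯ b_{i+k-1}`. -/
def seg (g : ℕ) (b : ℕ → Letter g) (i k : ℕ) : Word g :=
  (List.range k).map fun j => b (i + j)

/-- `dseg g b i k` is the descending word `b_i b_{i-1} ⋯ b_{i-k+1}`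
(indices taken modulo `4g`, using periodicity of `b`). -/
def dseg (g : ℕ) (b : ℕ → Letter g) (i k : ℕ) : Word g :=
  (List.range k).map fun j => b (i + 4*g - j)

/-- `b : ℕ → Letter g` is a `4g`-periodic (1-based) enumeration of the letters
`b₁, …, b_{4g}` of some word `b₁⋯b_{4g} ∈ 𝓡`. -/
def RelSeq (g : ℕ) (b : ℕ → Letter g) : Prop :=
  (∀ i, b (i + 4*g) = b i) ∧ seg g b 1 (4*g) ∈ RSet g

/-- The `t`-th power `W^t` of a word. -/
def wpow (g : ℕ) (W : Word g) (t : ℕ) : Word g := (List.replicate t W).flatten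

/-- A `k`-fractional relator: an initial segment of length `k` (with `2 ≤ k ≤ 4g`)
of some word in `𝓡`. -/
def IsFR (g : ℕ) (k : ℕ) (W : Word g) : Prop :=
  2 ≤ k ∧ k ≤ 4*g ∧ ∃ B ∈ RSet g, W = B.take k

/-- `IsLLFROcc g k W P F Q` : the factorization `W = P ++ F ++ Q` exhibits `F`
as a `k`-locally longest fractional relator of `W`. -/
def IsLLFROcc (g : ℕ) (k : ℕ) (W P F Q : Word g) : Prop :=
  W = P ++ F ++ Q ∧ IsFR g k F ∧
  (∀ a, P.getLast? = some a → ¬ IsFR g (k+1) (a :: F)) ∧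
  (∀ a, Q.head? = some a → ¬ IsFR g (k+1) (F ++ [a]))

/-- `W` contains a `k`-LLFR. -/
def HasLLFR (g : ℕ) (k : ℕ) (W : Word g) : Prop :=
  ∃ P F Q, IsLLFROcc g k W P F Q

/-- Length-lexicographical order on pairs of words. -/
def pairLt (g : ℕ) (p q : Word g × Word g) : Prop :=
  wordLt g p.1 q.1 ∨ (p.1 = q.1 ∧ wordLt g p.2 q.2)

/-- A candidate for the reducing-subword pair of `(W₁, W₂)`. -/
def IsRSCand (g : ℕ) (W₁ W₂ C₁ C₂ : Word g) : Prop :=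
  ∃ A B C' : Word g, W₁ = A ++ C₁ ∧ W₂ = C₂ ++ B ∧
    nf g (eval g (W₁ ++ W₂)) = A ++ C' ++ B

/-- `(C₁, C₂)` is the reducing-subword pair `rs(W₁, W₂)`: the `≺`-least candidate. -/
def IsRS (g : ℕ) (W₁ W₂ C₁ C₂ : Word g) : Prop :=
  IsRSCand g W₁ W₂ C₁ C₂ ∧
  ∀ D₁ D₂ : Word g, IsRSCand g W₁ W₂ D₁ D₂ →
    (C₁ = D₁ ∧ C₂ = D₂) ∨ pairLt g (C₁, C₂) (D₁, D₂)

end SG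


namespace SGP
open SG

/-- Cyclic enumeration of the letters: `c₁,…,c_{2g},c₁⁻¹,…,c_{2g}⁻¹`, period `4g`. -/
def L {g : ℕ} (h : 0 < 2*g) (n : ℕ) : Letter g :=
  (⟨n % (2*g), Nat.mod_lt _ h⟩, decide ((n/(2*g)) % 2 = 0))

/-- A run of `n` consecutive letters. -/
def run {g : ℕ} (h : 0 < 2*g) (k n : ℕ) : Word g := (List.range n).map fun j => L h (k + j)

section letters
variable {g : ℕ} (h : 0 < 2*g)

theorem L_add (k : ℕ) : L h (k + 2*g) = invLetter g (L h k) := by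
  unfold L invLetter
  ext
  · simp
  · have : (k + 2*g) / (2*g) = k/(2*g) + 1 := Nat.add_div_right k h
    simp only [this]
    rcases Nat.mod_two_eq_zero_or_one (k/(2*g)) with e | e <;> simp [Nat.add_mod, e]

theorem inv_inv (a : Letter g) : invLetter g (invLetter g a) = a := by
  simp [invLetter]

theorem L_add4 (k : ℕ) : L h (k + 4*g) = L h k := by
  have : k + 4*g = k + 2*g + 2*g := by ring
  rw [this, L_add, L_add, inv_inv]

theorem L_of_lt {k : ℕ} (hk : k < 2*g) : L h k = (⟨k, hk⟩, true) := by
  unfold L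
  simp [Nat.mod_eq_of_lt hk, Nat.div_eq_of_lt hk]

theorem L_of_lt' {k : ℕ} (hk : k < 2*g) : L h (k + 2*g) = (⟨k, hk⟩, false) := by
  rw [L_add, L_of_lt h hk]; rfl

theorem L_surj (a : Letter g) : ∃ k < 4*g, L h k = a := by
  obtain ⟨⟨i, hi⟩, b⟩ := a
  cases b
  · exact ⟨i + 2*g, by omega, L_of_lt' h hi⟩
  · exact ⟨i, by omega, L_of_lt h hi⟩

theorem L_mod (k : ℕ) : L h (k % (4*g)) = L h k := by
  have : ∀ q r, L h (r + 4*g*q) = L h r := by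
    intro q
    induction q with
    | zero => simp
    | succ q ih =>
      intro r
      have : r + 4*g*(q+1) = (r + 4*g*q) + 4*g := by ring
      rw [this, L_add4, ih]
  conv_rhs => rw [← Nat.mod_add_div k (4*g)]
  rw [this]

theorem L_inj {k l : ℕ} (hk : k < 4*g) (hl : l < 4*g) (e : L h k = L h l) : k = l := by
  by_cases h1 : k < 2*g <;> by_cases h2 : l < 2*g
  · rw [L_of_lt h h1, L_of_lt h h2] at e; simpa using e
  · obtain ⟨l', rfl⟩ := Nat.exists_eq_add_of_le' (not_lt.1 h2)
    rw [L_of_lt h h1, L_of_lt' h (by omega)] at e; simp at e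
  · obtain ⟨l', rfl⟩ := Nat.exists_eq_add_of_le' (not_lt.1 h1)
    rw [L_of_lt h h2, L_of_lt' h (by omega)] at e; simp at e
  · obtain ⟨k', rfl⟩ := Nat.exists_eq_add_of_le' (not_lt.1 h1)
    obtain ⟨l', rfl⟩ := Nat.exists_eq_add_of_le' (not_lt.1 h2)
    rw [L_of_lt' h (by omega), L_of_lt' h (by omega)] at e; simpa using e

theorem L_eq_iff {k l : ℕ} : L h k = L h l ↔ k % (4*g) = l % (4*g) := by
  constructor
  · intro e
    exact L_inj h (Nat.mod_lt _ (by omega)) (Nat.mod_lt _ (by omega)) (by rw [L_mod, L_mod, e])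
  · intro e
    rw [← L_mod h k, e, L_mod]

theorem L_cases {k l : ℕ} (h1 : k < l + 8*g) (h2 : l < k + 8*g) (e : L h k = L h l) :
    k = l ∨ k = l + 4*g ∨ l = k + 4*g := by
  rw [L_eq_iff] at e
  have hk := Nat.mod_add_div k (4*g)
  have hl := Nat.mod_add_div l (4*g)
  set a := k / (4*g)
  set b := l / (4*g)
  rcases lt_trichotomy a b with c | c | c
  · obtain ⟨d, hd'⟩ := Nat.exists_eq_add_of_lt c
    have : d = 0 := by
      by_contra hd
      have : 1 ≤ d := Nat.one_le_iff_ne_zero.2 hd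
      have : 4*g*1 ≤ 4*g*d := Nat.mul_le_mul_left _ this
      have : 4*g*b = 4*g*a + 4*g*d + 4*g := by rw [hd']; ring
      omega
    subst this
    have : 4*g*b = 4*g*a + 4*g := by rw [hd']; ring
    omega
  · rw [c] at hk; omega
  · obtain ⟨d, hd'⟩ := Nat.exists_eq_add_of_lt c
    have : d = 0 := by
      by_contra hd
      have : 1 ≤ d := Nat.one_le_iff_ne_zero.2 hd
      have : 4*g*1 ≤ 4*g*d := Nat.mul_le_mul_left _ this
      have : 4*g*a = 4*g*b + 4*g*d + 4*g := by rw [hd']; ring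
      omega
    subst this
    have : 4*g*a = 4*g*b + 4*g := by rw [hd']; ring
    omega

theorem L_fst_iff {k l : ℕ} : (L h k).1 = (L h l).1 ↔ (L h k = L h l ∨ L h k = L h (l + 2*g)) := by
  rw [L_add]
  generalize L h k = a
  generalize L h l = b
  obtain ⟨i, x⟩ := a
  obtain ⟨j, y⟩ := b
  simp only [invLetter, Prod.mk.injEq]
  cases x <;> cases y <;> simp

theorem rank_L {k : ℕ} (hk : k < 4*g) : rank g (L h k) = if k < 2*g then 2*g - 1 - k else k := by
  split_ifs with c
  · rw [L_of_lt h c]; simp [rank]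
  · obtain ⟨k', rfl⟩ := Nat.exists_eq_add_of_le' (not_lt.1 c)
    rw [L_of_lt' h (by omega)]; simp [rank]; omega

theorem rank_inj {a b : Letter g} (e : rank g a = rank g b) : a = b := by
  obtain ⟨⟨i, hi⟩, x⟩ := a
  obtain ⟨⟨j, hj⟩, y⟩ := b
  cases x <;> cases y <;> simp [rank] at e ⊢ <;> omega

theorem run_length (k n : ℕ) : (run h k n).length = n := by simp [run]

theorem run_add (k m n : ℕ) : run h k (m + n) = run h k m ++ run h (k + m) n := by
  simp [run, List.range_add, Nat.add_assoc]

theorem run_one (k : ℕ) : run h k 1 = [L h k] := by simp [run]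

theorem run_zero (k : ℕ) : run h k 0 = [] := by simp [run]

theorem run_succ (k n : ℕ) : run h k (n+1) = L h k :: run h (k+1) n := by
  rw [Nat.add_comm n 1, run_add, run_one]; rfl

theorem run_succ' (k n : ℕ) : run h k (n+1) = run h k n ++ [L h (k+n)] := by
  rw [run_add, run_one]

theorem run_add4 (k n : ℕ) : run h (k + 4*g) n = run h k n := by
  unfold run
  congr 1
  funext j
  rw [← L_add4 h (k+j)]; congr 1; ring

theorem run_mod (k n : ℕ) : run h (k % (4*g)) n = run h k n := by
  unfold run
  congr 1
  funext j
  rw [L_eq_iff]; simp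

theorem mem_run {k n : ℕ} {a : Letter g} : a ∈ run h k n ↔ ∃ j < n, L h (k+j) = a := by
  simp [run]

theorem invRev_eq (W : Word g) : FreeGroup.invRev W = wordInv g W := rfl

theorem wordInv_append (A B : Word g) : wordInv g (A ++ B) = wordInv g B ++ wordInv g A := by
  simp [wordInv]

theorem wordInv_wordInv (A : Word g) : wordInv g (wordInv g A) = A := by
  simpa [invRev_eq] using FreeGroup.invRev_invRev (L₁ := A)

theorem wordInv_length (A : Word g) : (wordInv g A).length = A.length := by simp [wordInv]

theorem wordInv_reverse (A : Word g) : (wordInv g A).reverse = A.map (invLetter g) := by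
  simp [wordInv]

theorem wordInv_run (k n : ℕ) : wordInv g (run h k n) = (run h (k + 2*g) n).reverse := by
  unfold wordInv run
  congr 1
  rw [List.map_map]
  congr 1
  funext j
  simp only [Function.comp]
  rw [← L_add]; congr 1; ring

theorem wordInv_run_reverse (k n : ℕ) :
    wordInv g (run h k n).reverse = run h (k + 2*g) n := by
  have := wordInv_run h (k + 2*g) n
  have e : k + 2*g + 2*g = k + 4*g := by ring
  rw [e, run_add4] at this
  rw [← this, wordInv_wordInv]

theorem freelyReduced_iff (W : Word g) : FreelyReduced g W ↔ FreeGroup.IsReduced W := by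
  unfold FreelyReduced FreeGroup.IsReduced
  have : (fun a c : Letter g => c ≠ invLetter g a) = (fun a b => a.1 = b.1 → a.2 = b.2) := by
    funext a b
    obtain ⟨i, x⟩ := a
    obtain ⟨j, y⟩ := b
    simp only [invLetter, ne_eq, Prod.mk.injEq, eq_iff_iff]
    cases x <;> cases y <;> simp [eq_comm]
  rw [this]
  exact Iff.rfl

theorem red_pair {a b : Letter g} : (a.1 = b.1 → a.2 = b.2) ↔ b ≠ invLetter g a := by
  obtain ⟨i, x⟩ := a
  obtain ⟨j, y⟩ := b
  simp only [invLetter, ne_eq, Prod.mk.injEq]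
  cases x <;> cases y <;> simp [eq_comm]

theorem mk_append (A B : Word g) :
    (FreeGroup.mk (A ++ B)) = FreeGroup.mk A * FreeGroup.mk B := by
  rw [FreeGroup.mul_mk]

theorem mk_wordInv (A : Word g) : FreeGroup.mk (wordInv g A) = (FreeGroup.mk A)⁻¹ := by
  rw [FreeGroup.inv_mk]; rfl

theorem mk_eq_prod (W : Word g) : FreeGroup.mk W =
    (W.map fun a => cond a.2 (FreeGroup.of a.1) (FreeGroup.of a.1)⁻¹).prod := by
  rw [← FreeGroup.lift_mk, FreeGroup.lift_of_eq_id]; rfl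

theorem eval_eq (W : Word g) : eval g W = PresentedGroup.mk _ (FreeGroup.mk W) := by
  rw [mk_eq_prod, map_list_prod, List.map_map]
  unfold eval
  congr 2
  funext a
  obtain ⟨i, x⟩ := a
  cases x <;> simp [evalLetter, gen, PresentedGroup.of]

theorem eval_append (A B : Word g) : eval g (A ++ B) = eval g A * eval g B := by
  simp [eval]

theorem eval_wordInv (A : Word g) : eval g (wordInv g A) = (eval g A)⁻¹ := by
  rw [eval_eq, eval_eq, mk_wordInv, map_inv]

theorem eval_surj (u : SurfaceGroup g) : ∃ W, eval g W = u := by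
  obtain ⟨x, rfl⟩ := PresentedGroup.mk_surjective _ u
  exact ⟨x.toWord, by rw [eval_eq, FreeGroup.mk_toWord]⟩

theorem relator_eq : relator g = FreeGroup.mk (run h 0 (4*g)) := by
  have e : 4*g = 2*g + 2*g := by ring
  rw [e, run_add, mk_append, mk_eq_prod, mk_eq_prod]
  unfold relator
  congr 2
  · apply List.ext_getElem
    · simp [run]
    · intro n h1 h2
      simp at h1
      simp [run, L_of_lt h h1]
  · apply List.ext_getElem
    · simp [run]
    · intro n h1 h2
      simp at h1
      simp [run, Nat.add_comm (2*g) n, L_of_lt' h h1]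

theorem hom_run4 {H : Type*} [Group H] (F : FreeGroup (Fin (2*g)) →* H) (hF : F (relator g) = 1)
    (k : ℕ) : F (FreeGroup.mk (run h k (4*g))) = 1 := by
  induction k with
  | zero => rw [← relator_eq, hF]
  | succ k ih =>
    have e : (run h k (4*g)) ++ [L h (k + 4*g)] = [L h k] ++ run h (k+1) (4*g) := by
      rw [← run_succ', run_succ]; rfl
    have := congrArg (fun w => F (FreeGroup.mk w)) e
    simp only [mk_append, map_mul, ih, L_add4] at this
    simpa using this

theorem hom_flip {H : Type*} [Group H] (F : FreeGroup (Fin (2*g)) →* H) (hF : F (relator g) = 1)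
    (k : ℕ) : F (FreeGroup.mk (run h k (2*g)).reverse) = F (FreeGroup.mk (run h k (2*g))) := by
  have e : 4*g = 2*g + 2*g := by ring
  have := hom_run4 h F hF k
  rw [e, run_add, mk_append, map_mul] at this
  have e2 := wordInv_run_reverse h k (2*g)
  rw [← e2, mk_wordInv, map_inv] at this
  exact (mul_inv_eq_one.1 this).symm

theorem eval_flip (k : ℕ) : eval g (run h k (2*g)).reverse = eval g (run h k (2*g)) := by
  rw [eval_eq, eval_eq]
  exact hom_flip h (PresentedGroup.mk {relator g})
    (PresentedGroup.one_of_mem (Set.mem_singleton _)) k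

/-- A homomorphism kills the relator as soon as one HNN relation holds. -/
theorem hom_relator {H : Type*} [Group H] (F : FreeGroup (Fin (2*g)) →* H) (i : ℕ) (hi : i < 2*g)
    (hF : F (FreeGroup.mk [L h i]) * F (FreeGroup.mk (run h (i+1) (2*g-1))) =
      F (FreeGroup.mk (run h (i+1) (2*g-1)).reverse) * F (FreeGroup.mk [L h i])) :
    F (relator g) = 1 := by
  have e : 4*g = i + (1 + ((2*g-1) + (1 + (2*g-1-i)))) := by omega
  have e2 : (2*g-1) = (2*g-1-i) + i := by omega
  rw [relator_eq h, e, run_add, run_add, run_add, run_add]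
  simp only [mk_append, map_mul, run_one]
  have e3 : (run h (i+1) (2*g-1)).reverse = wordInv g (run h (i+1+2*g) (2*g-1)) := by
    rw [wordInv_run]
    have : i+1+2*g+2*g = i+1+4*g := by ring
    rw [this, run_add4]
  have e4 : run h (i+1+2*g) (2*g-1) = run h (i+1+2*g) (2*g-1-i) ++ run h 0 i := by
    conv_lhs => rw [e2]
    rw [run_add]
    have : i+1+2*g+(2*g-1-i) = 0+4*g := by omega
    rw [this, run_add4]
  rw [e3, e4, mk_wordInv, mk_append, map_inv, map_mul] at hF
  have e5 : (0 + i + 1 + (2*g-1)) = i + 2*g := by omega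
  have e6 : (0 + i) = i := by omega
  have e7 : L h (i + 2*g) = invLetter g (L h i) := L_add h i
  have e8 : FreeGroup.mk [invLetter g (L h i)] = (FreeGroup.mk [L h i])⁻¹ := by
    rw [← mk_wordInv]; rfl
  rw [e5, e6, e7, e8, map_inv]
  have e9 : i + 2*g + 1 = i + 1 + 2*g := by ring
  rw [e9]
  rw [← mul_assoc (F (FreeGroup.mk [L h i])), hF]
  group

end letters
end SGP

namespace SGP
open SG

section britton
variable {α : Type} [DecidableEq α]

theorem split_exists (i : α) (V : List (α × Bool)) :
    ∃ (s : List (α × Bool)) (r : List (Bool × List (α × Bool))),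
      V = s ++ (r.flatMap fun p => (i, p.1) :: p.2) ∧ (∀ a ∈ s, a.1 ≠ i) ∧
      ∀ p ∈ r, ∀ a ∈ p.2, a.1 ≠ i := by
  induction V with
  | nil => exact ⟨[], [], by simp⟩
  | cons a V ih =>
    obtain ⟨s, r, e, h1, h2⟩ := ih
    by_cases ha : a.1 = i
    · refine ⟨[], (a.2, s) :: r, ?_, by simp, ?_⟩
      · rw [e]; simp [← ha]
      · intro p hp
        rcases List.mem_cons.1 hp with rfl | hp
        · exact h1
        · exact h2 p hp
    · refine ⟨a :: s, r, by rw [e]; simp, ?_, h2⟩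
      intro b hb
      rcases List.mem_cons.1 hb with rfl | hb
      · exact ha
      · exact h1 b hb

theorem zpowersHom_inj {G : Type} [Group G] [IsMulTorsionFree G] {X : G} (hX : X ≠ 1) :
    Function.Injective (zpowersHom G X) := by
  rw [injective_iff_map_eq_one]
  intro a ha
  rw [zpowersHom_apply] at ha
  have := (IsMulTorsionFree.zpow_eq_one_iff_right hX).1 ha
  exact Multiplicative.toAdd.injective this

/-- The isomorphism between two infinite cyclic subgroups. -/
noncomputable def cycEquiv {G : Type} [Group G] [IsMulTorsionFree G] (X Y : G)
    (hX : X ≠ 1) (hY : Y ≠ 1) :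
    (zpowersHom G X).range ≃* (zpowersHom G Y).range :=
  (MonoidHom.ofInjective (zpowersHom_inj hX)).symm.trans
    (MonoidHom.ofInjective (zpowersHom_inj hY))

theorem cycEquiv_apply {G : Type} [Group G] [IsMulTorsionFree G] (X Y : G)
    (hX : X ≠ 1) (hY : Y ≠ 1) (m : X ∈ (zpowersHom G X).range) :
    ((cycEquiv X Y hX hY ⟨X, m⟩ : (zpowersHom G Y).range) : G) = Y := by
  have : (⟨X, m⟩ : (zpowersHom G X).range) =
      MonoidHom.ofInjective (zpowersHom_inj hX) (Multiplicative.ofAdd 1) := by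
    ext; rw [MonoidHom.ofInjective_apply]; simp
  rw [this, cycEquiv, MulEquiv.trans_apply, MulEquiv.symm_apply_apply,
    MonoidHom.ofInjective_apply]
  simp

/-- Map of the free group to the HNN extension sending `i` to the stable letter. -/
noncomputable def toHNN (i : α) (X Y : FreeGroup α) (hX : X ≠ 1) (hY : Y ≠ 1) :
    FreeGroup α →* HNNExtension (FreeGroup α) _ _ (cycEquiv X Y hX hY) :=
  FreeGroup.lift fun j => if j = i then HNNExtension.t else HNNExtension.of (FreeGroup.of j)

theorem toHNN_of (i : α) (X Y : FreeGroup α) (hX : X ≠ 1) (hY : Y ≠ 1)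
    (s : List (α × Bool)) (hs : ∀ a ∈ s, a.1 ≠ i) :
    toHNN i X Y hX hY (FreeGroup.mk s) = HNNExtension.of (FreeGroup.mk s) := by
  induction s with
  | nil =>
    have : FreeGroup.mk ([] : List (α × Bool)) = 1 := rfl
    rw [this, map_one, map_one]
  | cons a s ih =>
    have e : FreeGroup.mk (a :: s) = FreeGroup.mk [a] * FreeGroup.mk s := by
      rw [FreeGroup.mul_mk]; rfl
    rw [e, map_mul, map_mul, ih (fun b hb => hs b (List.mem_cons_of_mem _ hb))]
    congr 1
    have ha := hs a (List.mem_cons_self)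
    obtain ⟨j, b⟩ := a
    simp only at ha
    cases b
    · have : FreeGroup.mk [(j, false)] = (FreeGroup.of j)⁻¹ := by
        rw [FreeGroup.of, FreeGroup.inv_mk]; rfl
      rw [this, map_inv, map_inv]; simp [toHNN, ha]
    · have : FreeGroup.mk [(j, true)] = (FreeGroup.of j) := rfl
      rw [this]; simp [toHNN, ha]

theorem toHNN_t (i : α) (X Y : FreeGroup α) (hX : X ≠ 1) (hY : Y ≠ 1) (b : Bool) :
    toHNN i X Y hX hY (FreeGroup.mk [(i, b)]) =
      HNNExtension.t ^ (((cond b 1 (-1) : ℤˣ) : ℤ)) := by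
  cases b
  · have : FreeGroup.mk [(i, false)] = (FreeGroup.of i)⁻¹ := by
      rw [FreeGroup.of, FreeGroup.inv_mk]; rfl
    rw [this, map_inv]; simp [toHNN]
  · have : FreeGroup.mk [(i, true)] = (FreeGroup.of i) := rfl
    rw [this]; simp [toHNN]

theorem britton (i : α) (X Y : FreeGroup α) (hX : X ≠ 1) (hY : Y ≠ 1) (V : List (α × Bool))
    (hV : toHNN i X Y hX hY (FreeGroup.mk V) = 1) (hi : ∃ a ∈ V, a.1 = i) :
    ∃ pre s post b, V = pre ++ (i, b) :: s ++ (i, !b) :: post ∧ (∀ a ∈ s, a.1 ≠ i) ∧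
      ∃ n : ℤ, FreeGroup.mk s = (cond b X Y) ^ n := by
  obtain ⟨s, r, e, h1, h2⟩ := split_exists i V
  have hr : r ≠ [] := by
    rintro rfl
    obtain ⟨a, ha, ha'⟩ := hi
    rw [e] at ha
    exact h1 a (by simpa using ha) ha'
  set r' : List (ℤˣ × FreeGroup α) := r.map fun p => (cond p.1 1 (-1), FreeGroup.mk p.2) with hr'
  by_cases hc : r'.IsChain (fun a b => a.2 ∈ HNNExtension.toSubgroup (zpowersHom _ X).range
      (zpowersHom _ Y).range a.1 → a.1 = b.1)
  · exfalso
    let w : HNNExtension.NormalWord.ReducedWord (FreeGroup α) (zpowersHom _ X).range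
      (zpowersHom _ Y).range := ⟨FreeGroup.mk s, r', hc⟩
    have hw : w.prod (cycEquiv X Y hX hY) = toHNN i X Y hX hY (FreeGroup.mk V) := by
      have : ∀ r : List (Bool × List (α × Bool)), (∀ p ∈ r, ∀ a ∈ p.2, a.1 ≠ i) →
          toHNN i X Y hX hY (FreeGroup.mk (r.flatMap fun p => (i, p.1) :: p.2)) =
          ((r.map fun p => ((cond p.1 1 (-1) : ℤˣ), FreeGroup.mk p.2)).map
            (fun x => HNNExtension.t ^ ((x.1 : ℤˣ) : ℤ) * HNNExtension.of x.2)).prod := by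
        intro r
        induction r with
        | nil => intro _; exact map_one _
        | cons p r ih =>
          intro hp
          have e : FreeGroup.mk (List.flatMap (fun p => (i, p.1) :: p.2) (p :: r)) =
            FreeGroup.mk [(i, p.1)] * FreeGroup.mk p.2 *
              FreeGroup.mk (List.flatMap (fun p => (i, p.1) :: p.2) r) := by
            rw [FreeGroup.mul_mk, FreeGroup.mul_mk]; simp
          rw [e, map_mul, map_mul, ih (fun q hq => hp q (List.mem_cons_of_mem _ hq)), toHNN_t,
            toHNN_of _ _ _ _ _ _ (hp p List.mem_cons_self)]
          simp
      rw [e, ← FreeGroup.mul_mk, map_mul, this r h2, toHNN_of _ _ _ _ _ _ h1]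
      rfl
    rw [hV] at hw
    have := HNNExtension.ReducedWord.toList_eq_nil_of_mem_of_range (cycEquiv X Y hX hY) w
      (by rw [hw]; exact one_mem _)
    apply hr
    simpa [w, hr'] using this
  · rw [List.isChain_iff_forall_rel_of_append_cons_cons] at hc
    push Not at hc
    obtain ⟨a, b, l1, l2, e1, h3, h4⟩ := hc
    rw [hr', List.map_eq_append_iff] at e1
    obtain ⟨r1, r2, rfl, er1, er2⟩ := e1
    rw [List.map_eq_cons_iff] at er2
    obtain ⟨p, r3, rfl, ep, er3⟩ := er2
    rw [List.map_eq_cons_iff] at er3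
    obtain ⟨q, r4, rfl, eq, er4⟩ := er3
    subst ep eq
    refine ⟨s ++ r1.flatMap (fun p => (i, p.1) :: p.2), p.2,
      q.2 ++ r4.flatMap (fun p => (i, p.1) :: p.2), p.1, ?_, h2 p (by simp), ?_⟩
    · have : q.1 = !p.1 := by
        revert h4
        cases p.1 <;> cases q.1 <;> simp
      rw [e, ← this]; simp
    · revert h3
      cases p.1
      · rintro ⟨n, hn⟩; exact ⟨Multiplicative.toAdd n, by rw [← zpowersHom_apply]; exact hn.symm⟩
      · rintro ⟨n, hn⟩; exact ⟨Multiplicative.toAdd n, by rw [← zpowersHom_apply]; exact hn.symm⟩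

theorem britton_of (i : α) (X Y : FreeGroup α) (hX : X ≠ 1) (hY : Y ≠ 1) (V : List (α × Bool))
    (hV : toHNN i X Y hX hY (FreeGroup.mk V) = 1) (hi : ∀ a ∈ V, a.1 ≠ i) :
    FreeGroup.mk V = 1 := by
  rw [toHNN_of _ _ _ _ _ _ hi] at hV
  exact (map_eq_one_iff _ (HNNExtension.of_injective _)).1 hV

/-- A reduced word representing a power of a cyclically reduced word is literally a power. -/
theorem literal_pow {x s : List (α × Bool)} (hx : FreeGroup.IsCyclicallyReduced x)
    (hs : FreeGroup.IsReduced s) (n : ℕ) (e : FreeGroup.mk s = (FreeGroup.mk x) ^ n) :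
    s = (List.replicate n x).flatten := by
  have h2 : FreeGroup.mk s = FreeGroup.mk (List.replicate n x).flatten := by
    rw [e]
    clear e
    induction n with
    | zero => rfl
    | succ n ih => rw [pow_succ', ih, FreeGroup.mul_mk]; simp [List.replicate_succ]
  have := FreeGroup.reduce.sound h2
  rwa [hs.reduce_eq, (hx.flatten_replicate n).isReduced.reduce_eq] at this

end britton
end SGP

namespace SGP
open SG

section pinch
variable {g : ℕ} (h : 0 < 2*g)

theorem L_ne (hg : 2 ≤ g) {k l : ℕ} (h1 : k < l) (h2 : l < k + 4*g) : L h k ≠ L h l := by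
  intro e
  rcases L_cases h (by omega) (by omega) e with e | e | e <;> omega

theorem run_cyc (hg : 2 ≤ g) (k n : ℕ) (hn : n ≤ 2*g) : FreeGroup.IsCyclicallyReduced (run h k n) := by
  refine ⟨?_, ?_⟩
  · unfold FreeGroup.IsReduced
    rw [List.isChain_iff_getElem]
    intro j hj
    rw [red_pair]
    simp only [run, List.getElem_map, List.getElem_range]
    rw [← L_add]
    exact (L_ne h hg (by omega) (by omega))
  · intro a ha b hb
    rw [red_pair]
    cases n with
    | zero => simp [run_zero] at ha
    | succ n =>
      rw [run_succ'] at ha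
      rw [run_succ] at hb
      simp at ha hb
      subst ha hb
      rw [← L_add]
      exact L_ne h hg (by omega) (by omega)

theorem run_rev_cyc (hg : 2 ≤ g) (k n : ℕ) (hn : n ≤ 2*g) :
    FreeGroup.IsCyclicallyReduced (run h k n).reverse := by
  refine ⟨?_, ?_⟩
  · unfold FreeGroup.IsReduced
    rw [List.isChain_reverse, List.isChain_iff_getElem]
    intro j hj
    rw [red_pair]
    simp only [run, List.getElem_map, List.getElem_range]
    rw [← L_add]
    exact (L_ne h hg (by omega) (by omega))
  · intro a ha b hb
    rw [red_pair]
    cases n with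
    | zero => simp [run_zero] at ha
    | succ n =>
      rw [List.getLast?_reverse, run_succ] at ha
      rw [List.head?_reverse, run_succ'] at hb
      simp at ha hb
      subst ha hb
      rw [← L_add]
      exact L_ne h hg (by omega) (by omega)

theorem mk_run_ne (hg : 2 ≤ g) (k n : ℕ) (hn : n ≤ 2*g) (h0 : 0 < n) : FreeGroup.mk (run h k n) ≠ 1 := by
  intro e
  have h2 : FreeGroup.mk (run h k n) = FreeGroup.mk [] := e
  have := FreeGroup.reduce.sound h2
  rw [(run_cyc h hg k n hn).isReduced.reduce_eq] at this
  have := congrArg List.length this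
  rw [run_length] at this
  simp at this; omega

theorem mk_run_rev_ne (hg : 2 ≤ g) (k n : ℕ) (hn : n ≤ 2*g) (h0 : 0 < n) :
    FreeGroup.mk (run h k n).reverse ≠ 1 := by
  intro e
  have h2 : FreeGroup.mk (run h k n).reverse = FreeGroup.mk [] := e
  have := FreeGroup.reduce.sound h2
  rw [(run_rev_cyc h hg k n hn).isReduced.reduce_eq] at this
  have := congrArg List.length this
  rw [List.length_reverse, run_length] at this
  simp at this; omega

/-- A half relator. -/
def IsHalf (w : Word g) : Prop := ∃ k, w = run h k (2*g) ∨ w = (run h k (2*g)).reverse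

theorem IsHalf.eval_eq {w : Word g} (hw : IsHalf h w) : eval g w.reverse = eval g w := by
  obtain ⟨k, rfl | rfl⟩ := hw
  · exact eval_flip h k
  · rw [List.reverse_reverse]; exact (eval_flip h k).symm

theorem pow_cases {x s : Word g} (hx : FreeGroup.IsCyclicallyReduced x)
    (hx' : FreeGroup.IsCyclicallyReduced (wordInv g x)) (hs : FreeGroup.IsReduced s) (n : ℤ)
    (e : FreeGroup.mk s = (FreeGroup.mk x) ^ n) (hne : s ≠ []) :
    ∃ m, 0 < m ∧ (s = (List.replicate m x).flatten ∨ s = (List.replicate m (wordInv g x)).flatten) := by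
  obtain ⟨m, rfl | rfl⟩ := Int.eq_nat_or_neg n
  · have := literal_pow hx hs m (by rw [e, zpow_natCast])
    refine ⟨m, ?_, Or.inl this⟩
    rcases Nat.eq_zero_or_pos m with rfl | hm
    · simp at this; exact absurd this hne
    · exact hm
  · have := literal_pow hx' hs m (by rw [e, mk_wordInv, inv_pow, zpow_neg, zpow_natCast])
    refine ⟨m, ?_, Or.inr this⟩
    rcases Nat.eq_zero_or_pos m with rfl | hm
    · simp at this; exact absurd this hne
    · exact hm

theorem pinch_exists (hg : 2 ≤ g) (V : Word g) (hV : FreeGroup.IsReduced V) (e : eval g V = 1)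
    (i : Fin (2*g)) (hi : ∃ a ∈ V, a.1 = i) :
    ∃ pre a z m post, V = pre ++ a :: (List.replicate m z).flatten ++ invLetter g a :: post ∧
      0 < m ∧ a.1 = i ∧ (∀ b ∈ z, b.1 ≠ i) ∧ z ≠ [] ∧ IsHalf h (a :: z) ∧
      IsHalf h (z ++ [invLetter g a]) := by
  set x := run h (i+1) (2*g-1) with hx
  have hX : FreeGroup.mk x ≠ 1 := mk_run_ne h hg _ _ (by omega) (by omega)
  have hY : FreeGroup.mk x.reverse ≠ 1 := mk_run_rev_ne h hg _ _ (by omega) (by omega)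
  have hxi : ∀ b ∈ x, b.1 ≠ i := by
    intro b hb hbi
    obtain ⟨j, hj, rfl⟩ := (mem_run h).1 hb
    have : i = (L h i).1 := by rw [L_of_lt h i.2]
    rw [this, L_fst_iff] at hbi
    rcases hbi with hbi | hbi
    · exact L_ne h hg (by omega) (by omega) hbi.symm
    · exact L_ne h hg (by omega) (by omega) hbi
  have hLi : L h i = (i, true) := by rw [L_of_lt h i.2]
  have hLi' : L h (i + 2*g) = (i, false) := by rw [L_of_lt' h i.2]
  have hF : toHNN i (FreeGroup.mk x) (FreeGroup.mk x.reverse) hX hY (relator g) = 1 := by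
    apply hom_relator h _ i i.2
    rw [← hx, toHNN_of _ _ _ _ _ x hxi, toHNN_of _ _ _ _ _ x.reverse (by simpa using hxi), hLi,
      toHNN_t]
    simp only [cond_true, Units.val_one, zpow_one]
    have hm : FreeGroup.mk x ∈ (zpowersHom (FreeGroup (Fin (2*g))) (FreeGroup.mk x)).range :=
      ⟨Multiplicative.ofAdd 1, by simp⟩
    have := HNNExtension.t_mul_of (φ := cycEquiv (FreeGroup.mk x) (FreeGroup.mk x.reverse) hX hY)
      ⟨_, hm⟩
    rwa [cycEquiv_apply] at this
  have hV1 : toHNN i (FreeGroup.mk x) (FreeGroup.mk x.reverse) hX hY (FreeGroup.mk V) = 1 := by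
    have hker : ∀ r ∈ ({relator g} : Set (FreeGroup (Fin (2*g)))),
      toHNN i (FreeGroup.mk x) (FreeGroup.mk x.reverse) hX hY r = 1 := by
      rintro r rfl; exact hF
    rw [eval_eq] at e
    have hle : Subgroup.normalClosure {relator g} ≤
        (toHNN i (FreeGroup.mk x) (FreeGroup.mk x.reverse) hX hY).ker :=
      Subgroup.normalClosure_le_normal (fun r hr => hker r hr)
    exact hle ((QuotientGroup.eq_one_iff _).1 e)
  obtain ⟨pre, s, post, b, eV, hs, n, hn⟩ := britton i _ _ hX hY V hV1 hi
  have hsr : FreeGroup.IsReduced s := hV.infix ⟨pre ++ [(i, b)], (i, !b) :: post, by rw [eV]; simp⟩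
  have hne : s ≠ [] := by
    rintro rfl
    have : FreeGroup.IsReduced ([(i, b), (i, !b)] : Word g) := hV.infix ⟨pre, post, by rw [eV]; simp⟩
    cases b <;> simp [FreeGroup.IsReduced] at this
  have hwx : wordInv g x = (run h (i+1+2*g) (2*g-1)).reverse := wordInv_run h _ _
  have hwx' : wordInv g x.reverse = (run h (i+1+2*g) (2*g-1)) := wordInv_run_reverse h _ _
  have hcyc1 : FreeGroup.IsCyclicallyReduced x := run_cyc h hg _ _ (by omega)
  have hcyc2 : FreeGroup.IsCyclicallyReduced x.reverse := run_rev_cyc h hg _ _ (by omega)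
  have key : ∃ z m, 0 < m ∧ s = (List.replicate m z).flatten ∧
      ∃ k, 1 ≤ k ∧ ((L h k = (i, b) ∧ z = run h (k+1) (2*g-1)) ∨
        (L h (k + (2*g-1)) = (i, b) ∧ z = (run h k (2*g-1)).reverse)) := by
    cases b
    · obtain ⟨m, hm, em | em⟩ := pow_cases hcyc2
        (by rw [hwx']; exact run_cyc h hg _ _ (by omega)) hsr n hn hne
      · refine ⟨_, m, hm, em, i+1, by omega, Or.inr ⟨?_, rfl⟩⟩
        rw [← hLi']; congr 1; omega
      · refine ⟨_, m, hm, em, i+2*g, by omega, Or.inl ⟨hLi', ?_⟩⟩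
        have e9 : (i : ℕ) + 1 + 2*g = i + 2*g + 1 := by omega
        rw [hwx', e9]
    · obtain ⟨m, hm, em | em⟩ := pow_cases hcyc1
        (by rw [hwx]; exact run_rev_cyc h hg _ _ (by omega)) hsr n hn hne
      · refine ⟨_, m, hm, em, i+4*g, by omega, Or.inl ⟨by rw [L_add4, hLi], ?_⟩⟩
        rw [hx, ← run_add4]; congr 1; omega
      · refine ⟨_, m, hm, em, i+1+2*g, by omega, Or.inr ⟨?_, hwx⟩⟩
        rw [← hLi, ← L_add4 h i]; congr 1; omega
  obtain ⟨z, m, hm, es, k, hk, hz⟩ := key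
  have hsz : ∀ a ∈ z, a ∈ s := by
    intro a ha
    rw [es]
    simp only [List.mem_flatten, List.mem_replicate]
    exact ⟨z, ⟨by omega, rfl⟩, ha⟩
  have e2 : 2*g = (2*g-1)+1 := by omega
  have hinv : invLetter g (i, b) = (i, !b) := rfl
  refine ⟨pre, (i, b), z, m, post, by rw [eV, es]; rfl, hm, rfl, fun a ha => hs a (hsz a ha), ?_, ?_⟩
  · rintro rfl
    apply hne
    rw [es]; simp
  rcases hz with ⟨hz1, hz2⟩ | ⟨hz1, hz2⟩
  · constructor
    · exact ⟨k, Or.inl (by rw [← hz1, hz2, e2, run_succ]; congr 2)⟩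
    · refine ⟨k+1, Or.inl ?_⟩
      rw [← hz1, hz2, ← L_add]
      conv_rhs => rw [e2, run_succ']
      congr 3; omega
  · obtain ⟨k, rfl⟩ := Nat.exists_eq_add_of_le' hk
    constructor
    · refine ⟨k+1, Or.inr ?_⟩
      rw [← hz1, hz2]
      conv_rhs => rw [e2, run_succ']
      simp
    · refine ⟨k, Or.inr ?_⟩
      rw [← hz1, hz2]
      conv_rhs => rw [e2, run_succ]
      have e3 : k + 1 + (2*g-1) = k + 2*g := by omega
      rw [e3, L_add, inv_inv]
      simp

theorem trivial_word (hg : 2 ≤ g) (V : Word g) (hV : FreeGroup.IsReduced V) (e : eval g V = 1) :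
    V ≠ [] → ∃ pre a z m post,
      V = pre ++ a :: (List.replicate m z).flatten ++ invLetter g a :: post ∧ 0 < m ∧
      IsHalf h (a :: z) := by
  intro hne
  obtain ⟨a, V', rfl⟩ := List.exists_cons_of_ne_nil hne
  obtain ⟨pre, b, z, m, post, h1, h2, _, _, _, h3, _⟩ :=
    pinch_exists h hg _ hV e a.1 ⟨a, by simp, rfl⟩
  exact ⟨pre, b, z, m, post, h1, h2, h3⟩

/-- Evaluation of a pinch. -/
theorem eval_pinch {a : Letter g} {z : Word g} (hz : IsHalf h (a :: z)) (m : ℕ) :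
    eval g (a :: (List.replicate m z).flatten ++ [invLetter g a]) =
      eval g (List.replicate m z.reverse).flatten := by
  have e := hz.eval_eq
  rw [List.reverse_cons, eval_append] at e
  have e1 : eval g (a :: z) = eval g [a] * eval g z := eval_append [a] z
  have e2 : eval g [invLetter g a] = (eval g [a])⁻¹ := eval_wordInv [a]
  have e3 : eval g (a :: (List.replicate m z).flatten) = eval g [a] * eval g _ := eval_append [a] _
  rw [eval_append, e2, e3]
  rw [e1] at e
  clear e1 e2 e3
  induction m with
  | zero => simp [eval]
  | succ m ih =>
    rw [List.replicate_succ, List.replicate_succ, List.flatten_cons, List.flatten_cons, eval_append,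
      eval_append, ← ih, ← mul_assoc, ← e]
    group

end pinch
end SGP

namespace SGP
open SG

section key
variable {g : ℕ} (h : 0 < 2*g)

/-- Geodesic words. -/
def Geo (W : Word g) : Prop := ∀ W', eval g W' = eval g W → W.length ≤ W'.length

theorem Geo.of_infix {A B C : Word g} (hW : Geo (A ++ B ++ C)) : Geo B := by
  intro B' e
  have := hW (A ++ B' ++ C) (by simp only [eval_append, e])
  simp at this; omega

theorem Geo.inv {A : Word g} (hW : Geo A) : Geo (wordInv g A) := by
  intro B' e
  have := hW (wordInv g B') (by rw [eval_wordInv, e, eval_wordInv, _root_.inv_inv])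
  rw [wordInv_length] at *
  exact this

theorem eval_cancel (a : Letter g) : eval g [a, invLetter g a] = 1 := by
  have := eval_append [a] [invLetter g a]
  have e2 : eval g [invLetter g a] = (eval g [a])⁻¹ := eval_wordInv [a]
  rw [e2, mul_inv_cancel] at this
  exact this

theorem eval_nil : eval g [] = 1 := rfl

theorem Geo.isReduced {W : Word g} (hW : Geo W) : FreeGroup.IsReduced W := by
  unfold FreeGroup.IsReduced
  rw [List.isChain_iff_forall_rel_of_append_cons_cons]
  intro a b l1 l2 e
  rw [red_pair]
  rintro rfl
  have : W = l1 ++ [a, invLetter g a] ++ l2 := by rw [e]; simp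
  rw [this] at hW
  have := hW.of_infix [] (by rw [eval_cancel]; rfl)
  simp at this

theorem Geo.no_pinch {a : Letter g} {z pre post : Word g} (hz : IsHalf h (a :: z)) (m : ℕ)
    (hW : Geo (pre ++ (a :: (List.replicate m z).flatten ++ [invLetter g a]) ++ post)) : False := by
  have := hW.of_infix _ (eval_pinch h hz m).symm
  simp at this

/-- Forbidden (non-preferred) half relators. -/
def Nonpref (w : Word g) : Prop :=
  ∃ k, 2*g+1 ≤ k ∧ k ≤ 4*g ∧ (w = run h k (2*g) ∨ w = wordInv g (run h k (2*g)))

theorem half_nonpref (hg : 2 ≤ g) {w : Word g} (hw : IsHalf h w) {d d' : Letter g}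
    (hd : w.head? = some d) (hd' : w.getLast? = some d') (hr : rank g d' < rank g d) :
    Nonpref h w := by
  obtain ⟨k, hk⟩ := hw
  have hkk : ∃ k, k < 4*g ∧ (w = run h k (2*g) ∨ w = (run h k (2*g)).reverse) :=
    ⟨k % (4*g), Nat.mod_lt _ (by omega), by rw [run_mod]; exact hk⟩
  clear hk k
  obtain ⟨k, hk4, hk⟩ := hkk
  have e2 : 2*g = (2*g-1)+1 := by omega
  have h1 : (run h k (2*g)).head? = some (L h k) := by rw [e2, run_succ]; rfl
  have h2 : (run h k (2*g)).getLast? = some (L h (k + (2*g-1))) := by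
    rw [e2, run_succ']; simp
  have r1 := rank_L h hk4
  have r2 : rank g (L h (k + (2*g-1))) = if k = 0 then 0 else if k ≤ 2*g then k + (2*g-1)
      else (4*g - k) := by
    split_ifs with c1 c2
    · subst c1
      rw [rank_L h (by omega), if_pos (by omega)]; omega
    · rw [rank_L h (by omega), if_neg (by omega)]
    · have : k + (2*g-1) = (k - 2*g - 1) + 4*g := by omega
      rw [this, L_add4, rank_L h (by omega), if_pos (by omega)]; omega
  rcases hk with rfl | rfl
  · rw [h1] at hd
    rw [h2] at hd'
    cases hd; cases hd'
    rw [r1, r2] at hr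
    by_cases hk0 : k = 0
    · subst hk0
      exact ⟨4*g, by omega, le_rfl, Or.inl (by rw [← run_add4 h 0]; simp)⟩
    · refine ⟨k, ?_, hk4.le, Or.inl rfl⟩
      by_contra hc
      rw [if_neg hk0, if_pos (by omega)] at hr
      split_ifs at hr <;> omega
  · rw [List.head?_reverse, h2] at hd
    rw [List.getLast?_reverse, h1] at hd'
    cases hd; cases hd'
    rw [r1, r2] at hr
    refine ⟨k + 2*g, ?_, ?_, Or.inr ?_⟩
    · by_contra hc
      have : k = 0 := by omega
      subst this
      simp at hr
    · by_contra hc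
      rw [if_neg (by omega), if_neg (by omega), if_neg (by omega)] at hr
      omega
    · rw [wordInv_run]
      have : k + 2*g + 2*g = k + 4*g := by ring
      rw [this, run_add4]

theorem strip : ∀ (W W' : Word g), W.length = W'.length → W ≠ W' →
    ∃ C d D d' D', W = C ++ d :: D ∧ W' = C ++ d' :: D' ∧ d ≠ d' := by
  intro W
  induction W with
  | nil => intro W' e ne; exact absurd (List.length_eq_zero_iff.1 e.symm).symm ne
  | cons a W ih =>
    intro W' e ne
    cases W' with
    | nil => simp at e
    | cons b W' =>
      by_cases hab : a = b
      · subst hab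
        obtain ⟨C, d, D, d', D', h1, h2, h3⟩ := ih W' (by simpa using e) (by simpa using ne)
        exact ⟨a :: C, d, D, d', D', by rw [h1]; rfl, by rw [h2]; rfl, h3⟩
      · exact ⟨[], a, W, b, W', rfl, rfl, hab⟩

theorem lex_append {r : Letter g → Letter g → Prop} (C : Word g) {d d' : Letter g} (D D' : Word g)
    (hr : r d d') : List.Lex r (C ++ d :: D) (C ++ d' :: D') := by
  induction C with
  | nil => exact List.Lex.rel hr
  | cons a C ih => exact List.Lex.cons ih

theorem key_lemma (hg : 2 ≤ g) {W : Word g} (hW : Geo W)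
    (hN : ∀ A B C, W = A ++ B ++ C → ¬ Nonpref h B) : IrreducibleWord g W := by
  intro W' e
  by_cases hne : W' = W
  · exact Or.inl hne
  right
  rcases lt_or_eq_of_le (hW W' e) with hl | hl
  · exact Or.inl hl
  right
  refine ⟨hl, ?_⟩
  obtain ⟨C, d, D, d', D', e1, e2, hd⟩ := strip W W' hl (Ne.symm hne)
  have hW' : Geo W' := by intro U hU; rw [← hl]; exact hW U (hU.trans e)
  rcases lt_trichotomy (rank g d) (rank g d') with hr | hr | hr
  · rw [e1, e2]; exact lex_append C D D' hr
  · exact absurd (rank_inj hr) hd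
  exfalso
  have hG : Geo (d :: D) := by
    apply Geo.of_infix (A := C) (C := [])
    rw [List.append_nil, ← e1]; exact hW
  have hG' : Geo (d' :: D') := by
    apply Geo.of_infix (A := C) (C := [])
    rw [List.append_nil, ← e2]; exact hW'
  have hi : wordInv g (d' :: D') = wordInv g D' ++ [invLetter g d'] := wordInv_append [d'] D'
  have hVr : FreeGroup.IsReduced (wordInv g (d' :: D') ++ d :: D) := by
    unfold FreeGroup.IsReduced
    rw [List.isChain_append]
    refine ⟨hG'.inv.isReduced, hG.isReduced, ?_⟩
    intro x hx y hy
    rw [hi] at hx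
    simp at hx hy
    subst hx hy
    rw [red_pair, inv_inv]
    exact hd
  have hVe : eval g (wordInv g (d' :: D') ++ d :: D) = 1 := by
    rw [e1, e2, eval_append, eval_append] at e
    rw [eval_append, eval_wordInv, mul_left_cancel e]
    group
  obtain ⟨pre, a, z, m, post, eV, hm, ha, hz, hz0, hh1, hh2⟩ :=
    pinch_exists h hg _ hVr hVe d'.1 ⟨invLetter g d', by rw [hi]; simp, rfl⟩
  set zs := (List.replicate m z).flatten with hzs
  have eV' : wordInv g (d' :: D') ++ d :: D = pre ++ (a :: zs ++ invLetter g a :: post) := by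
    rw [eV]; simp
  rcases List.append_eq_append_iff.1 eV' with ⟨as, h1, h2⟩ | ⟨bs, h1, h2⟩
  · rw [h2] at hG
    refine Geo.no_pinch h (pre := as) (post := post) hh1 m ?_
    rw [← hzs]; simpa using hG
  · rcases List.eq_nil_or_concat bs with rfl | ⟨bs', b, rfl⟩
    · rw [List.nil_append] at h2
      rw [← h2] at hG
      refine Geo.no_pinch h (pre := []) (post := post) hh1 m ?_
      rw [← hzs]; simpa using hG
    rw [List.concat_eq_append] at h1 h2
    have hb : b = invLetter g d' := by
      rw [hi, ← List.append_assoc] at h1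
      have := congrArg List.getLast? h1
      simp at this
      exact this.symm
    rcases List.append_eq_append_iff.1 h2 with ⟨as, h3, h4⟩ | ⟨cs, h3, h4⟩
    · cases as with
      | nil =>
        rw [List.append_nil] at h3
        rw [List.nil_append] at h4
        have hmem : b ∈ zs := by
          cases bs' with
          | nil =>
            simp at h3
            have : z = [] := by
              have : zs = [] := h3.2.symm ▸ rfl
              rw [hzs] at this
              simp at this
              exact this (by omega)
            exact absurd this hz0
          | cons c bs' =>
            simp at h3
            rw [← h3.2]; simp
        rw [hzs] at hmem
        simp only [List.mem_flatten, List.mem_replicate] at hmem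
        obtain ⟨z', ⟨_, rfl⟩, hb'⟩ := hmem
        exact hz b hb' (by rw [hb]; rfl)
      | cons c as =>
        simp at h4
        obtain ⟨rfl, h4⟩ := h4
        have := hG'.inv
        rw [h1, h3] at this
        refine Geo.no_pinch h (pre := pre) (post := as) hh1 m ?_
        rw [← hzs]; simpa using this
    · cases bs' with
      | nil =>
        simp at h3
        obtain ⟨rfl, h3⟩ := h3
        subst hb
        rw [inv_inv] at h4 hh2
        rw [← h3] at h4
        obtain ⟨m, rfl⟩ := Nat.exists_eq_add_of_le' hm
        have hhead : (z ++ [d']).head? = some d := by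
          obtain ⟨c, z, rfl⟩ := List.exists_cons_of_ne_nil hz0
          rw [hzs, List.replicate_succ] at h4
          simp at h4
          simp [h4.1]
        have hnp := half_nonpref h hg hh2 hhead (by simp) hr
        refine hN (C ++ (List.replicate m z).flatten) (z ++ [d']) post ?_ hnp
        rw [e1, h4, hzs, List.replicate_succ']
        simp
      | cons c bs' =>
        simp at h3
        have hmem : b ∈ zs := by rw [h3.2]; simp
        rw [hzs] at hmem
        simp only [List.mem_flatten, List.mem_replicate] at hmem
        obtain ⟨z', ⟨_, rfl⟩, hb'⟩ := hmem
        exact hz b hb' (by rw [hb]; rfl)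

end key
end SGP

namespace SGP
open SG

section potential
variable {g : ℕ} (h : 0 < 2*g)

/-- Successor relation on letters in the cyclic enumeration. -/
def Nx (a b : Letter g) : Prop := ∃ k, a = L h k ∧ b = L h (k+1)

theorem Nx.inv {a b : Letter g} (e : Nx h a b) : Nx h (invLetter g a) (invLetter g b) := by
  obtain ⟨k, rfl, rfl⟩ := e
  exact ⟨k + 2*g, by rw [L_add], by rw [← L_add]; congr 1; omega⟩

theorem Nx_inv_iff {a b : Letter g} : Nx h (invLetter g a) (invLetter g b) ↔ Nx h a b := by
  constructor
  · intro e
    have := e.inv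
    rwa [inv_inv, inv_inv] at this
  · exact Nx.inv h

theorem Nx_right {k : ℕ} {b : Letter g} (e : Nx h (L h k) b) : b = L h (k+1) := by
  obtain ⟨l, h1, rfl⟩ := e
  rw [L_eq_iff] at h1 ⊢
  rw [Nat.add_mod, ← h1, ← Nat.add_mod]

theorem Nx_left {k : ℕ} {a : Letter g} (e : Nx h a (L h (k+1))) : a = L h k := by
  obtain ⟨l, rfl, h1⟩ := e
  rw [L_eq_iff] at h1 ⊢
  exact (Nat.ModEq.add_right_cancel' 1 h1).symm

open Classical in
/-- Weight of an adjacent pair. -/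
noncomputable def pw (S : Letter g → Prop) (a b : Letter g) : ℕ :=
  (if Nx h a b ∧ S a then 1 else 0) + (if Nx h b a ∧ S (invLetter g b) then 1 else 0)

theorem pw_inv (S : Letter g → Prop) (a b : Letter g) :
    pw h S (invLetter g b) (invLetter g a) = pw h S a b := by
  unfold pw
  rw [Nx_inv_iff, Nx_inv_iff, inv_inv, Nat.add_comm]

/-- Sum of the weights of adjacent pairs of a list. -/
noncomputable def pc (S : Letter g → Prop) : Word g → ℕ
  | [] => 0
  | [_] => 0
  | a :: b :: l => pw h S a b + pc S (b :: l)

theorem pc_split (S : Letter g → Prop) (A : Word g) (x : Letter g) (B : Word g) :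
    pc h S (A ++ x :: B) = pc h S (A ++ [x]) + pc h S (x :: B) := by
  induction A with
  | nil => simp [pc]
  | cons a A ih =>
    cases A with
    | nil => simp [pc]
    | cons b A =>
      simp only [List.cons_append, pc] at ih ⊢
      rw [ih]; omega

theorem pc_two (S : Letter g → Prop) (A : Word g) (x y : Letter g) (B : Word g) :
    pc h S (A ++ x :: y :: B) = pc h S (A ++ [x]) + pw h S x y + pc h S (y :: B) := by
  rw [pc_split, pc]; omega

theorem pc_inv (S : Letter g → Prop) (A : Word g) : pc h S (wordInv g A) = pc h S A := by
  induction A with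
  | nil => rfl
  | cons a A ih =>
    cases A with
    | nil => rfl
    | cons b A =>
      have e1 : wordInv g (a :: b :: A) = wordInv g A ++ invLetter g b :: [invLetter g a] := by
        simp [wordInv]
      have e2 : wordInv g (b :: A) = wordInv g A ++ [invLetter g b] := by
        simp [wordInv]
      rw [e1, pc_split, ← e2, ih, pc, pc, pw_inv, pc]; omega

/-- Cyclic potential. -/
noncomputable def cp (S : Letter g → Prop) : Word g → ℕ
  | [] => 0
  | a :: l => pc h S (a :: l ++ [a])

theorem cp_append (S : Letter g → Prop) (A B : Word g) : cp h S (A ++ B) = cp h S (B ++ A) := by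
  cases A with
  | nil => simp
  | cons a A =>
    cases B with
    | nil => simp
    | cons b B =>
      have e1 : cp h S (a :: A ++ b :: B) = pc h S ((a :: A) ++ b :: (B ++ [a])) := by
        simp [cp]
      have e2 : cp h S (b :: B ++ a :: A) = pc h S ((b :: B) ++ a :: (A ++ [b])) := by
        simp [cp]
      rw [e1, e2, pc_split, pc_split h S (b :: B)]
      simp only [List.cons_append]; omega

theorem rot_split {A B : Word g} (e : A ~r B) : ∃ U V, A = U ++ V ∧ B = V ++ U := by
  obtain ⟨n, rfl⟩ := e
  exact ⟨_, _, (List.take_append_drop (n % A.length) A).symm, List.rotate_eq_drop_append_take_mod⟩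

theorem cp_rot (S : Letter g → Prop) {A B : Word g} (e : A ~r B) : cp h S A = cp h S B := by
  obtain ⟨U, V, rfl, rfl⟩ := rot_split e
  exact cp_append h S U V

theorem cp_inv (S : Letter g → Prop) (A : Word g) : cp h S (wordInv g A) = cp h S A := by
  cases A with
  | nil => rfl
  | cons a A =>
    have e1 : wordInv g (a :: A) = wordInv g A ++ [invLetter g a] := by simp [wordInv]
    rw [e1, cp_append]
    have e2 : cp h S ([invLetter g a] ++ wordInv g A) = pc h S (wordInv g (a :: A ++ [a])) := by
      simp [cp, wordInv]
    rw [e2, pc_inv]; rfl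

open Classical in
/-- Indicator. -/
noncomputable def ind (p : Prop) : ℕ := if p then 1 else 0

theorem pw_fwd (S : Letter g → Prop) {a b : Letter g} (h1 : Nx h a b) (h2 : ¬ Nx h b a) :
    pw h S a b = ind (S a) := by
  unfold pw ind
  split_ifs <;> first | rfl | tauto

theorem pw_bwd (S : Letter g → Prop) {a b : Letter g} (h1 : Nx h a b) (h2 : ¬ Nx h b a) :
    pw h S b a = ind (S (invLetter g a)) := by
  unfold pw ind
  split_ifs <;> first | rfl | tauto

theorem pw_run (hg : 2 ≤ g) (S : Letter g → Prop) (k : ℕ) :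
    pw h S (L h k) (L h (k+1)) = ind (S (L h k)) := by
  have h1 : Nx h (L h k) (L h (k+1)) := ⟨k, rfl, rfl⟩
  have h2 : ¬ Nx h (L h (k+1)) (L h k) := by
    intro e
    exact L_ne h hg (by omega) (by omega) (Nx_right h e)
  exact pw_fwd h S h1 h2

theorem pw_run' (hg : 2 ≤ g) (S : Letter g → Prop) (k : ℕ) :
    pw h S (L h (k+1)) (L h k) = ind (S (L h (k+2*g))) := by
  have h1 : Nx h (L h k) (L h (k+1)) := ⟨k, rfl, rfl⟩
  have h2 : ¬ Nx h (L h (k+1)) (L h k) := by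
    intro e
    exact L_ne h hg (by omega) (by omega) (Nx_right h e)
  rw [L_add]; exact pw_bwd h S h1 h2

theorem pc_run (hg : 2 ≤ g) (S : Letter g → Prop) (k n : ℕ) :
    pc h S (run h k (n+1)) = ∑ j ∈ Finset.range n, ind (S (L h (k+j))) := by
  induction n with
  | zero => simp [run_one, pc]
  | succ n ih =>
    rw [Finset.sum_range_succ, ← ih]
    have e : run h k (n+1+1) = run h k n ++ L h (k+n) :: [L h (k+n+1)] := by
      rw [run_succ', run_succ']; simp [Nat.add_assoc]
    rw [e, pc_split, ← run_succ', pc, pc, pw_run h hg]; omega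

theorem pc_run_rev (hg : 2 ≤ g) (S : Letter g → Prop) (k n : ℕ) :
    pc h S (run h k (n+1)).reverse = ∑ j ∈ Finset.range n, ind (S (L h (k+j+2*g))) := by
  induction n with
  | zero => simp [run_one, pc]
  | succ n ih =>
    rw [Finset.sum_range_succ, ← ih]
    have e : (run h k (n+1+1)).reverse = L h (k+n+1) :: L h (k+n) :: (run h k n).reverse := by
      rw [run_succ', run_succ']; simp [Nat.add_assoc]
    have e' : (run h k (n+1)).reverse = L h (k+n) :: (run h k n).reverse := by
      rw [run_succ']; simp
    rw [e, pc, e', pw_run' h hg]; omega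

/-- Upper bound after the flip, lower bound before. -/
theorem flip_bounds (hg : 2 ≤ g) (S : Letter g → Prop) (k : ℕ) (N : Word g)
    (hr1 : FreeGroup.IsReduced (run h k (2*g) ++ N))
    (hr2 : FreeGroup.IsReduced (N ++ run h k (2*g)))
    (hS : ∀ j, j < 2*g-1 → ¬ S (L h (k+j+2*g))) :
    cp h S ((run h k (2*g)).reverse ++ N) ≤ pc h S N + ind (S (L h k)) + ind (S (L h (k+(2*g-2)))) ∧
    pc h S N + ∑ j ∈ Finset.range (2*g-1), ind (S (L h (k+j))) ≤ cp h S (run h k (2*g) ++ N) := by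
  have e1 : 2*g = (2*g-1)+1 := by omega
  have e2 : 2*g-1 = (2*g-2)+1 := by omega
  have hpc := pc_run h hg S k (2*g-1)
  have hpc' := pc_run_rev h hg S k (2*g-1)
  rw [← e1] at hpc hpc'
  have hz : ∑ j ∈ Finset.range (2*g-1), ind (S (L h (k+j+2*g))) = 0 := by
    apply Finset.sum_eq_zero
    intro j hj
    simp [ind, hS j (Finset.mem_range.1 hj)]
  rw [hz] at hpc'
  have r1 : run h k (2*g) = L h k :: run h (k+1) (2*g-1) := by conv_lhs => rw [e1, run_succ]
  have r2 : run h k (2*g) = run h k (2*g-1) ++ [L h (k+(2*g-1))] := by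
    conv_lhs => rw [e1, run_succ']
  have q1 : (run h k (2*g)).reverse = (run h (k+1) (2*g-1)).reverse ++ [L h k] := by rw [r1]; simp
  have q2 : (run h k (2*g)).reverse = L h (k+(2*g-1)) :: (run h k (2*g-1)).reverse := by
    rw [r2]; simp
  rcases List.eq_nil_or_concat N with rfl | ⟨N1, w, hN⟩
  · rw [List.append_nil, List.append_nil]
    have c1 : cp h S (run h k (2*g)) = pc h S (run h k (2*g)) + pw h S (L h (k+(2*g-1))) (L h k) := by
      have : cp h S (run h k (2*g)) = pc h S (run h k (2*g) ++ [L h k]) := by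
        conv_lhs => rw [r1]
        conv_rhs => rw [r1]
        rfl
      rw [this]
      conv_lhs => rw [r2, List.append_assoc]
      rw [List.singleton_append, pc_two, ← r2]; simp [pc]
    have c2 : cp h S (run h k (2*g)).reverse =
        pc h S (run h k (2*g)).reverse + pw h S (L h k) (L h (k+(2*g-1))) := by
      have : cp h S (run h k (2*g)).reverse =
          pc h S ((run h k (2*g)).reverse ++ [L h (k+(2*g-1))]) := by
        conv_lhs => rw [q2]
        conv_rhs => rw [q2]
        rfl
      rw [this]
      conv_lhs => rw [q1, List.append_assoc]
      rw [List.singleton_append, pc_two, ← q1]; simp [pc]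
    have c3 : pw h S (L h k) (L h (k+(2*g-1))) = 0 := by
      have n1 : ¬ Nx h (L h k) (L h (k+(2*g-1))) := by
        intro e
        exact L_ne h hg (by omega) (by omega) (Nx_right h e).symm
      have n2 : ¬ Nx h (L h (k+(2*g-1))) (L h k) := by
        intro e
        exact L_ne h hg (by omega) (by omega) (Nx_right h e)
      simp [pw, n1, n2]
    rw [c1, c2, c3, hpc, hpc']
    simp [pc]
  · rw [List.concat_eq_append] at hN
    obtain ⟨v, N2, hN2⟩ : ∃ v N2, N = v :: N2 := List.exists_cons_of_ne_nil (by rw [hN]; simp)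
    have c1 : cp h S (run h k (2*g) ++ N) = pc h S (run h k (2*g)) + pw h S (L h (k+(2*g-1))) v +
        pc h S N + pw h S w (L h k) := by
      have : cp h S (run h k (2*g) ++ N) = pc h S (run h k (2*g) ++ (N ++ [L h k])) := by
        rw [← List.append_assoc]
        conv_lhs => rw [r1]
        conv_rhs => rw [r1]
        rfl
      rw [this]
      conv_lhs => rw [r2, List.append_assoc, hN2]
      rw [List.singleton_append, List.cons_append, pc_two, ← r2, ← List.cons_append, ← hN2]
      conv_lhs => rw [hN, List.append_assoc]
      rw [List.singleton_append, pc_two, ← hN]; simp [pc]; omega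
    have c2 : cp h S ((run h k (2*g)).reverse ++ N) = pc h S (run h k (2*g)).reverse +
        pw h S (L h k) v + pc h S N + pw h S w (L h (k+(2*g-1))) := by
      have : cp h S ((run h k (2*g)).reverse ++ N) =
          pc h S ((run h k (2*g)).reverse ++ (N ++ [L h (k+(2*g-1))])) := by
        rw [← List.append_assoc]
        conv_lhs => rw [q2]
        conv_rhs => rw [q2]
        rfl
      rw [this]
      conv_lhs => rw [q1, List.append_assoc, hN2]
      rw [List.singleton_append, List.cons_append, pc_two, ← q1, ← List.cons_append, ← hN2]
      conv_lhs => rw [hN, List.append_assoc]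
      rw [List.singleton_append, pc_two, ← hN]; simp [pc]; omega
    have c3 : pw h S (L h k) v ≤ ind (S (L h k)) := by
      have n2 : ¬ Nx h v (L h k) := by
        intro e
        have hv : v = L h (k + (2*g-1) + 2*g) := by
          apply Nx_left
          rw [← L_add4] at e
          convert e using 2; omega
        rw [r2, hN2] at hr1
        have := hr1.infix (L₁ := [L h (k+(2*g-1)), v]) ⟨run h k (2*g-1), N2, by simp⟩
        simp only [FreeGroup.IsReduced, List.isChain_pair] at this
        rw [red_pair, ← L_add] at this
        exact this hv
      by_cases s : S (L h k) <;> simp [pw, n2, s, ind]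
      split_ifs <;> omega
    have c4 : pw h S w (L h (k+(2*g-1))) ≤ ind (S (L h (k+(2*g-2)))) := by
      have n2 : ¬ Nx h (L h (k+(2*g-1))) w := by
        intro e
        have hv : w = L h (k + 2*g) := by
          rw [Nx_right h e]; congr 1; omega
        rw [r1, hN] at hr2
        have := hr2.infix (L₁ := [w, L h k]) ⟨N1, run h (k+1) (2*g-1), by simp⟩
        simp only [FreeGroup.IsReduced, List.isChain_pair] at this
        rw [red_pair, hv, L_add, inv_inv] at this
        exact this rfl
      by_cases n1 : Nx h w (L h (k+(2*g-1)))
      · have hw : w = L h (k+(2*g-2)) := by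
          apply Nx_left
          convert n1 using 2; omega
        rw [pw_fwd h S n1 n2, ← hw]
      · simp [pw, n1, n2]
    rw [c1, c2, hpc, hpc']
    constructor <;> omega

theorem flip_le (hg : 2 ≤ g) (S : Letter g → Prop) (k : ℕ) (N : Word g)
    (hr1 : FreeGroup.IsReduced (run h k (2*g) ++ N))
    (hr2 : FreeGroup.IsReduced (N ++ run h k (2*g)))
    (hS : ∀ j, j < 2*g-1 → ¬ S (L h (k+j+2*g))) :
    cp h S ((run h k (2*g)).reverse ++ N) ≤ cp h S (run h k (2*g) ++ N) := by
  obtain ⟨b1, b2⟩ := flip_bounds h hg S k N hr1 hr2 hS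
  have hsub : ({0, 2*g-2} : Finset ℕ) ⊆ Finset.range (2*g-1) := by
    intro x hx; simp at hx ⊢; omega
  have := Finset.sum_le_sum_of_subset (f := fun j => ind (S (L h (k+j)))) hsub
  rw [Finset.sum_pair (by omega)] at this
  simp only [Nat.add_zero] at this
  omega

theorem flip_lt (hg : 2 ≤ g) (S : Letter g → Prop) (k : ℕ) (N : Word g)
    (hr1 : FreeGroup.IsReduced (run h k (2*g) ++ N))
    (hr2 : FreeGroup.IsReduced (N ++ run h k (2*g)))
    (hS : ∀ j, j < 2*g-1 → ¬ S (L h (k+j+2*g))) (i : ℕ) (h0 : 0 < i) (hi : i < 2*g-2)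
    (hSi : S (L h (k+i))) :
    cp h S ((run h k (2*g)).reverse ++ N) < cp h S (run h k (2*g) ++ N) := by
  obtain ⟨b1, b2⟩ := flip_bounds h hg S k N hr1 hr2 hS
  have hsub : ({i, 0, 2*g-2} : Finset ℕ) ⊆ Finset.range (2*g-1) := by
    intro x hx; simp at hx ⊢; omega
  have := Finset.sum_le_sum_of_subset (f := fun j => ind (S (L h (k+j)))) hsub
  rw [Finset.sum_insert (by simp; omega), Finset.sum_pair (by omega)] at this
  simp only [Nat.add_zero] at this
  have h1 : ind (S (L h (k+i))) = 1 := by simp [ind, hSi]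
  omega

end potential
end SGP

namespace SGP
open SG

section combin
variable {g : ℕ} (h : 0 < 2*g)

/-- Classes of words closed under rotation and relator flips, all freely reduced. -/
structure Good (K : Word g → Prop) : Prop where
  rot : ∀ A B, K (A ++ B) → K (B ++ A)
  flip : ∀ k N, K (run h k (2*g) ++ N) → K ((run h k (2*g)).reverse ++ N)
  flip' : ∀ k N, K ((run h k (2*g)).reverse ++ N) → K (run h k (2*g) ++ N)
  red : ∀ W, K W → FreeGroup.IsReduced W

variable {h}

theorem Good.rot' {K : Word g → Prop} (hK : Good h K) {A B : Word g} (hA : K A) (e : A ~r B) :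
    K B := by
  obtain ⟨U, V, rfl, rfl⟩ := rot_split e
  exact hK.rot _ _ hA

theorem wordInv_rot {A B : Word g} (e : A ~r B) : wordInv g A ~r wordInv g B := by
  obtain ⟨U, V, rfl, rfl⟩ := rot_split e
  rw [wordInv_append, wordInv_append]
  exact List.isRotated_append

theorem red_inv {A : Word g} (hA : FreeGroup.IsReduced (wordInv g A)) : FreeGroup.IsReduced A := by
  have := congrArg FreeGroup.invRev hA.reduce_eq
  rw [← FreeGroup.reduce_invRev, invRev_eq, wordInv_wordInv] at this
  exact FreeGroup.IsReduced.of_reduce_eq this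

theorem Good.inv {K : Word g → Prop} (hK : Good h K) : Good h (fun W => K (wordInv g W)) where
  rot := by
    intro A B hA
    rw [wordInv_append] at *
    exact hK.rot _ _ hA
  flip := by
    intro k N hA
    rw [wordInv_append] at *
    rw [wordInv_run] at hA
    rw [wordInv_run_reverse]
    exact hK.rot _ _ (hK.flip' _ _ (hK.rot _ _ hA))
  flip' := by
    intro k N hA
    rw [wordInv_append] at *
    rw [wordInv_run_reverse] at hA
    rw [wordInv_run]
    exact hK.rot _ _ (hK.flip _ _ (hK.rot _ _ hA))
  red := fun W hW => red_inv (hK.red _ hW)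

theorem Good.le {K : Word g → Prop} (hK : Good h K) (hg : 2 ≤ g) (S : Letter g → Prop) (k : ℕ)
    (N : Word g) (hW : K (run h k (2*g) ++ N)) (hS : ∀ j, j < 2*g-1 → ¬ S (L h (k+j+2*g))) :
    cp h S ((run h k (2*g)).reverse ++ N) ≤ cp h S (run h k (2*g) ++ N) :=
  flip_le h hg S k N (hK.red _ hW) (hK.red _ (hK.rot _ _ hW)) hS

theorem Good.lt {K : Word g → Prop} (hK : Good h K) (hg : 2 ≤ g) (S : Letter g → Prop) (k : ℕ)
    (N : Word g) (hW : K (run h k (2*g) ++ N)) (hS : ∀ j, j < 2*g-1 → ¬ S (L h (k+j+2*g)))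
    (i : ℕ) (h0 : 0 < i) (hi : i < 2*g-2) (hSi : S (L h (k+i))) :
    cp h S ((run h k (2*g)).reverse ++ N) < cp h S (run h k (2*g) ++ N) :=
  flip_lt h hg S k N (hK.red _ hW) (hK.red _ (hK.rot _ _ hW)) hS i h0 hi hSi

variable (h)

/-- First potential set. -/
def S1 (a : Letter g) : Prop := a = L h (4*g-1)
/-- Second potential set. -/
def S2 (a : Letter g) : Prop := a = L h (4*g-2)
/-- Third potential set. -/
def S3 (a : Letter g) : Prop := a = L h 0 ∨ a = L h 1

/-- No cyclic occurrence of the pattern starting at `2g+1`, nor of its inverse. -/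
def NoB (W : Word g) : Prop :=
  (∀ M, ¬ W ~r (run h (2*g+1) (2*g) ++ M)) ∧ (∀ M, ¬ W ~r (wordInv g (run h (2*g+1) (2*g)) ++ M))

variable {h}

theorem NoB.rot {A B : Word g} (hA : NoB h A) (e : A ~r B) : NoB h B :=
  ⟨fun M e' => hA.1 M (e.trans e'), fun M e' => hA.2 M (e.trans e')⟩

theorem NoB.inv {A : Word g} (hA : NoB h A) : NoB h (wordInv g A) := by
  constructor
  · intro M e
    have := wordInv_rot e
    rw [wordInv_wordInv, wordInv_append] at this
    exact hA.2 _ (this.trans List.isRotated_append)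
  · intro M e
    have := wordInv_rot e
    rw [wordInv_wordInv, wordInv_append, wordInv_wordInv] at this
    exact hA.1 _ (this.trans List.isRotated_append)

theorem L_ne' (hg : 2 ≤ g) {k l : ℕ} (h1 : k ≠ l) (h2 : k < l + 4*g) (h3 : l < k + 4*g) :
    L h k ≠ L h l := by
  intro e
  rcases L_cases h (by omega) (by omega) e with e | e | e <;> omega

theorem S1_no (hg : 2 ≤ g) {k : ℕ} (h1 : 2*g+1 ≤ k) (h2 : k ≤ 4*g) :
    ∀ j, j < 2*g-1 → ¬ S1 h (L h (k+j+2*g)) := by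
  intro j hj e
  have e3 : k + j + 2*g = (k + j - 2*g) + 4*g := by omega
  unfold S1 at e
  rw [e3, L_add4] at e
  exact L_ne' hg (by omega) (by omega) (by omega) e

theorem M1_flip {K : Word g → Prop} (hK : Good h K) (hg : 2 ≤ g) {n : ℕ}
    (hn : ∀ W, K W → n ≤ cp h (S1 h) W) {k : ℕ} (h1 : 2*g+1 ≤ k) (h2 : k ≤ 4*g) {N : Word g}
    (hW : K (run h k (2*g) ++ N)) (hW1 : cp h (S1 h) (run h k (2*g) ++ N) = n) :
    cp h (S1 h) ((run h k (2*g)).reverse ++ N) = n := by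
  have := hK.le hg (S1 h) k N hW (S1_no hg h1 h2)
  have := hn _ (hK.flip _ _ hW)
  omega

theorem M1_mid {K : Word g → Prop} (hK : Good h K) (hg : 2 ≤ g) {n : ℕ}
    (hn : ∀ W, K W → n ≤ cp h (S1 h) W) {k : ℕ} (h1 : 2*g+1 ≤ k) (h2 : k ≤ 4*g) {N : Word g}
    (hW : K (run h k (2*g) ++ N)) (hW1 : cp h (S1 h) (run h k (2*g) ++ N) = n) :
    k = 2*g+1 ∨ k = 4*g-1 ∨ k = 4*g := by
  by_contra hc
  have := hK.lt hg (S1 h) k N hW (S1_no hg h1 h2) (4*g-1-k) (by omega) (by omega)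
    (by unfold S1; congr 1; omega)
  have := hn _ (hK.flip _ _ hW)
  omega

theorem lemB {K : Word g → Prop} (hK : Good h K) (hg : 2 ≤ g) {n : ℕ}
    (hn : ∀ W, K W → n ≤ cp h (S1 h) W) {W : Word g} (hW : K W) (hW1 : cp h (S1 h) W = n)
    (hmin : ∀ W', K W' → cp h (S1 h) W' = n → cp h (S2 h) W ≤ cp h (S2 h) W') (M : Word g) :
    ¬ W ~r (run h (2*g+1) (2*g) ++ M) := by
  intro e
  have hW' := hK.rot' hW e
  have hf := M1_flip hK hg hn le_rfl (by omega) hW' ((cp_rot h _ e).symm.trans hW1)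
  have := hmin _ (hK.flip _ _ hW') hf
  rw [cp_rot h _ e] at this
  have := hK.lt hg (S2 h) (2*g+1) M hW' (by
    intro j hj e
    have e3 : 2*g+1 + j + 2*g = (j+1) + 4*g := by omega
    unfold S2 at e
    rw [e3, L_add4] at e
    exact L_ne' hg (by omega) (by omega) (by omega) e) (2*g-3) (by omega) (by omega)
    (by unfold S2; congr 1; omega)
  omega

theorem NoB_flip {K : Word g → Prop} (hK : Good h K) (hg : 2 ≤ g) {k : ℕ}
    (hk : k = 4*g-1 ∨ k = 4*g) {N : Word g}
    (hW : K (run h k (2*g) ++ N)) (hB : NoB h (run h k (2*g) ++ N)) :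
    NoB h ((run h k (2*g)).reverse ++ N) := by
  have e1 : 2*g = (2*g-1)+1 := by omega
  have hr0 : (run h k (2*g)).reverse = L h (k+(2*g-1)) :: (run h k (2*g-1)).reverse := by
    conv_lhs => rw [e1, run_succ']
    simp
  have hh0 : run h k (2*g) = L h k :: run h (k+1) (2*g-1) := by conv_lhs => rw [e1, run_succ]
  -- general analysis
  have gen : ∀ (p M : Word g) (p0 : Letter g) (p' : Word g), p = p0 :: p' →
      p0 ∉ run h k (2*g) → (∀ M, ¬ (run h k (2*g) ++ N) ~r (p ++ M)) →
      ((run h k (2*g)).reverse ++ N) ~r (p ++ M) →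
      ∃ N1 N2 c p2, p = N2 ++ [c] ++ L h (k+(2*g-1)) :: p2 ∧ N = N1 ++ (N2 ++ [c]) := by
    intro p M p0 p' ep hp0 hno e
    obtain ⟨U, V, eU, eV⟩ := rot_split e
    have hp0r : p0 ∉ (run h k (2*g)).reverse := by simpa using hp0
    have main : ∀ N1, U = (run h k (2*g)).reverse ++ N1 → N = N1 ++ V →
        ∃ N1 N2 c p2, p = N2 ++ [c] ++ L h (k+(2*g-1)) :: p2 ∧ N = N1 ++ (N2 ++ [c]) := by
      intro N1 h1 h2
      rcases List.append_eq_append_iff.1 eV with ⟨M', h3, h4⟩ | ⟨p2, h3, h4⟩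
      · exfalso
        apply hno (M' ++ (run h k (2*g) ++ N1))
        rw [h2, h3]
        have : run h k (2*g) ++ (N1 ++ (p ++ M')) = (run h k (2*g) ++ N1) ++ (p ++ M') := by simp
        rw [this]
        have e5 : p ++ (M' ++ (run h k (2*g) ++ N1)) = (p ++ M') ++ (run h k (2*g) ++ N1) := by simp
        rw [e5]
        exact List.isRotated_append
      · cases p2 with
        | nil =>
          exfalso
          rw [List.append_nil] at h3
          apply hno (run h k (2*g) ++ N1)
          rw [h2, ← h3]
          have : run h k (2*g) ++ (N1 ++ p) = (run h k (2*g) ++ N1) ++ p := by simp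
          rw [this]
          exact List.isRotated_append
        | cons x p2 =>
          rw [h1, hr0] at h4
          simp only [List.cons_append, List.cons.injEq] at h4
          obtain ⟨rfl, h4⟩ := h4
          rcases List.eq_nil_or_concat V with rfl | ⟨N2, c, hV⟩
          · exfalso
            rw [ep] at h3
            simp at h3
            apply hp0r
            rw [hr0, h3.1]; simp
          · rw [List.concat_eq_append] at hV
            exact ⟨N1, N2, c, p2, by rw [h3, hV], by rw [h2, hV]⟩
    rcases List.append_eq_append_iff.1 eU with ⟨N1, h1, h2⟩ | ⟨r2, h1, h2⟩
    · exact main N1 h1 h2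
    · cases r2 with
      | nil => exact main [] (by simpa using h1.symm) (by simpa using h2.symm)
      | cons x r2 =>
        exfalso
        rw [h2, ep] at eV
        simp at eV
        apply hp0r
        rw [h1, eV.1]; simp
  constructor
  · intro M e
    obtain ⟨N1, N2, c, p2, h1, h2⟩ := gen _ M (L h (2*g+1)) (run h (2*g+1+1) (2*g-1))
      (by conv_lhs => rw [e1, run_succ]
          rw [← e1]) (by
        rw [mem_run]
        rintro ⟨j, hj, e⟩
        rcases hk with rfl | rfl
        · rcases L_cases h (by omega) (by omega) e with e | e | e <;> omega
        · rcases L_cases h (by omega) (by omega) e with e | e | e <;> omega) hB.1 e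
    have : L h (k+(2*g-1)) ∈ run h (2*g+1) (2*g) := by rw [h1]; simp
    rw [mem_run] at this
    obtain ⟨j, hj, e⟩ := this
    rcases hk with rfl | rfl
    · rcases L_cases h (by omega) (by omega) e with e | e | e <;> omega
    · rcases L_cases h (by omega) (by omega) e with e | e | e <;> omega
  · intro M e
    have hwi : wordInv g (run h (2*g+1) (2*g)) = (run h 1 (2*g)).reverse := by
      rw [wordInv_run]
      have : 2*g+1+2*g = 1+4*g := by ring
      rw [this, run_add4]
    obtain ⟨N1, N2, c, p2, h1, h2⟩ := gen _ M (L h (2*g)) (run h 1 (2*g-1)).reverse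
      (by rw [hwi]
          conv_lhs => rw [e1, run_succ']
          have : 1 + (2*g-1) = 2*g := by omega
          rw [this]; simp) (by
        rw [mem_run]
        rintro ⟨j, hj, e⟩
        rcases hk with rfl | rfl
        · rcases L_cases h (by omega) (by omega) e with e | e | e <;> omega
        · rcases L_cases h (by omega) (by omega) e with e | e | e <;> omega) hB.2 e
    -- the letter before the start of the flipped half cancels
    have hrun : run h 1 (2*g) = (p2.reverse ++ [L h (k+(2*g-1))]) ++ c :: N2.reverse := by
      rw [← List.reverse_reverse (run h 1 (2*g)), ← hwi, h1]
      simp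
    have hc : c = L h (k + 2*g) := by
      set t := p2.length with ht
      have hlen := congrArg List.length hrun
      rw [run_length] at hlen
      simp at hlen
      have a1 : (run h 1 (2*g))[t]? = some (L h (k+(2*g-1))) := by
        rw [hrun, List.append_assoc, List.getElem?_append_right (by simp [ht])]
        simp [ht]
      have a2 : (run h 1 (2*g))[t+1]? = some c := by
        rw [hrun, List.getElem?_append_right (by simp [ht])]
        simp [ht]
      have b1 : (run h 1 (2*g))[t]? = some (L h (1+t)) := by
        rw [List.getElem?_eq_getElem (by rw [run_length]; omega)]
        simp [run]
      have b2 : (run h 1 (2*g))[t+1]? = some (L h (1+t+1)) := by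
        rw [List.getElem?_eq_getElem (by rw [run_length]; omega)]
        simp [run, Nat.add_assoc]
      rw [b1] at a1
      rw [b2] at a2
      simp only [Option.some.injEq] at a1 a2
      have := Nx_right h (k := k + (2*g-1)) (b := c) ⟨1+t, a1.symm, a2.symm⟩
      rw [this]; congr 1; omega
    have hred := hK.red _ (hK.rot _ _ hW)
    rw [h2, hh0] at hred
    have := hred.infix (L₁ := [c, L h k]) ⟨N1 ++ N2, run h (k+1) (2*g-1), by simp⟩
    simp only [FreeGroup.IsReduced, List.isChain_pair] at this
    rw [red_pair, hc, L_add, inv_inv] at this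
    exact this rfl

theorem lemC {K : Word g → Prop} (hK : Good h K) (hg : 2 ≤ g) {n : ℕ}
    (hn : ∀ W, K W → n ≤ cp h (S1 h) W) {W : Word g} (hW : K W) (hW1 : cp h (S1 h) W = n)
    (hB : NoB h W)
    (hmin : ∀ W', K W' → cp h (S1 h) W' = n → NoB h W' → cp h (S3 h) W ≤ cp h (S3 h) W') {k : ℕ}
    (h1 : 2*g+1 ≤ k) (h2 : k ≤ 4*g) (M : Word g) : ¬ W ~r (run h k (2*g) ++ M) := by
  intro e
  have hW' := hK.rot' hW e
  have hW1' := (cp_rot h _ e).symm.trans hW1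
  have hf := M1_flip hK hg hn h1 h2 hW' hW1'
  rcases M1_mid hK hg hn h1 h2 hW' hW1' with rfl | hk
  · exact hB.1 _ e
  have hB' := NoB_flip hK hg hk hW' (hB.rot e)
  have := hmin _ (hK.flip _ _ hW') hf hB'
  rw [cp_rot h _ e] at this
  have := hK.lt hg (S3 h) k M hW' (by
    intro j hj e
    rcases e with e | e
    · rcases L_cases h (by omega) (by omega) e with e | e | e <;> omega
    · rcases L_cases h (by omega) (by omega) e with e | e | e <;> omega) 1 (by omega) (by omega)
    (by
      rcases hk with rfl | rfl
      · left; rw [← L_add4 h 0]; congr 1; omega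
      · right; rw [← L_add4 h 1]; congr 1; omega)
  omega

theorem exists_min {P : Word g → Prop} (hP : ∃ W, P W) (φ : Word g → ℕ) :
    ∃ W, P W ∧ ∀ W', P W' → φ W ≤ φ W' := by
  obtain ⟨W, h1, h2⟩ := WellFounded.has_min (measure φ).wf {W | P W} hP
  exact ⟨W, h1, fun W' h' => not_lt.1 (h2 W' h')⟩

theorem combin_main {K : Word g → Prop} (hK : Good h K) (hg : 2 ≤ g) (hne : ∃ W, K W) :
    ∃ W, K W ∧ ∀ B M, Nonpref h B → ¬ W ~r (B ++ M) := by
  obtain ⟨W1, hW1, hmin1⟩ := exists_min hne (cp h (S1 h))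
  set n := cp h (S1 h) W1 with hn
  obtain ⟨W2, ⟨hW2, hW2n⟩, hmin2⟩ := exists_min (P := fun W => K W ∧ cp h (S1 h) W = n)
    ⟨W1, hW1, rfl⟩ (cp h (S2 h))
  have hmin1' : ∀ W, K (wordInv g W) → n ≤ cp h (S1 h) W := by
    intro W hW
    rw [← cp_inv]; exact hmin1 _ hW
  have hB : NoB h W2 := by
    constructor
    · exact lemB hK hg hmin1 hW2 hW2n (fun W' a b => hmin2 W' ⟨a, b⟩)
    · intro M e
      have e' := wordInv_rot e
      rw [wordInv_append, wordInv_wordInv] at e'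
      refine lemB hK.inv hg hmin1' (W := wordInv g W2) (by rw [wordInv_wordInv]; exact hW2)
        (by rw [cp_inv]; exact hW2n) ?_ _ (e'.trans List.isRotated_append)
      intro W' a b
      have := hmin2 (wordInv g W') ⟨a, by rw [cp_inv]; exact b⟩
      rw [cp_inv] at this ⊢
      exact this
  obtain ⟨W, ⟨hW, hWn, hWB⟩, hmin3⟩ :=
    exists_min (P := fun W => K W ∧ cp h (S1 h) W = n ∧ NoB h W) ⟨W2, hW2, hW2n, hB⟩ (cp h (S3 h))
  refine ⟨W, hW, ?_⟩
  rintro B M ⟨k, h1, h2, rfl | rfl⟩ e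
  · exact lemC hK hg hmin1 hW hWn hWB (fun W' a b c => hmin3 W' ⟨a, b, c⟩) h1 h2 M e
  · have e' := wordInv_rot e
    rw [wordInv_append, wordInv_wordInv] at e'
    refine lemC hK.inv hg hmin1' (W := wordInv g W) (by rw [wordInv_wordInv]; exact hW)
      (by rw [cp_inv]; exact hWn) hWB.inv ?_ h1 h2 _ (e'.trans List.isRotated_append)
    intro W' a b c
    have := hmin3 (wordInv g W') ⟨a, by rw [cp_inv]; exact b, c.inv⟩
    rw [cp_inv] at this ⊢
    exact this

end combin
end SGP

namespace SGP
open SG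

section final
variable {g : ℕ}

theorem exists_irr (u : SurfaceGroup g) : ∃ W, eval g W = u ∧ IrreducibleWord g W := by
  have wf : WellFounded (letterLt g) := (measure (rank g)).wf
  obtain ⟨W, h1, h2⟩ := WellFounded.has_min (List.Shortlex.wf wf) {W | eval g W = u} (eval_surj u)
  haveI : Std.Trichotomous (letterLt g) :=
    ⟨fun a b h1 h2 => rank_inj (le_antisymm (not_lt.1 h2) (not_lt.1 h1))⟩
  refine ⟨W, h1, fun W' e => ?_⟩
  have h3 := h2 W' (e.trans h1)
  by_cases hne : W' = W
  · exact Or.inl hne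
  · right
    by_contra hc
    apply hne
    refine Std.Trichotomous.trichotomous (r := List.Shortlex (letterLt g)) _ _ h3 ?_
    intro h4
    exact hc (List.shortlex_def.1 h4)

theorem irr_geo {W : Word g} (hW : IrreducibleWord g W) : Geo W := by
  intro W' e
  rcases hW W' e with rfl | h | h
  · exact le_rfl
  · exact h.le
  · exact h.1.le

/-- Words of minimal length in a conjugacy class. -/
def MinConj (u : SurfaceGroup g) (W : Word g) : Prop :=
  IsConj u (eval g W) ∧ ∀ W', IsConj u (eval g W') → W.length ≤ W'.length

theorem MinConj.of_eq {u : SurfaceGroup g} {W W' : Word g} (hW : MinConj u W)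
    (hc : IsConj (eval g W) (eval g W')) (hl : W.length = W'.length) : MinConj u W' :=
  ⟨hW.1.trans hc, fun V hV => hl ▸ hW.2 V hV⟩

theorem conj_rot (A B : Word g) : IsConj (eval g (A ++ B)) (eval g (B ++ A)) := by
  rw [eval_append, eval_append, isConj_iff]
  exact ⟨(eval g A)⁻¹, by group⟩

theorem MinConj.geo {u : SurfaceGroup g} {W : Word g} (hW : MinConj u W) : Geo W := by
  intro W' e
  exact hW.2 W' (e ▸ hW.1)

theorem good_minConj (h : 0 < 2*g) (u : SurfaceGroup g) : Good h (MinConj u) where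
  rot := fun A B hW => hW.of_eq (conj_rot A B) (by simp [add_comm])
  flip := by
    intro k N hW
    refine hW.of_eq ?_ (by simp)
    rw [eval_append, eval_append, eval_flip]
  flip' := by
    intro k N hW
    refine hW.of_eq ?_ (by simp)
    rw [eval_append, eval_append, eval_flip]
  red := fun W hW => hW.geo.isReduced

theorem exists_cyc (hg : 2 ≤ g) (u : SurfaceGroup g) :
    ∃ W, IsConj u (eval g W) ∧ CyclicallyIrreducibleWord g W := by
  have h : 0 < 2*g := by omega
  have hne : ∃ W, MinConj u W := by
    obtain ⟨W0, hW0⟩ := eval_surj u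
    obtain ⟨W, h1, h2⟩ := exists_min (P := fun W => IsConj u (eval g W))
      ⟨W0, by rw [hW0]⟩ List.length
    exact ⟨W, h1, h2⟩
  obtain ⟨W, hW, hN⟩ := combin_main (good_minConj h u) hg hne
  refine ⟨W, hW.1, fun W' e => ?_⟩
  refine key_lemma h hg ((good_minConj h u).rot' hW e).geo ?_
  intro A B C eq hB
  refine hN B (C ++ A) hB (e.trans ?_)
  rw [eq, List.append_assoc, ← List.append_assoc B C A]
  exact List.isRotated_append

theorem exists_form {u : SurfaceGroup g} {A : Word g} (hu : IsConj u (eval g A))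
    (hA : CyclicallyIrreducibleWord g A) :
    ∃ X A', A ~r A' ∧ IrreducibleWord g X ∧ eval g (wordInv g X ++ A' ++ X) = u ∧
      FreelyReduced g (wordInv g X ++ A' ++ X) := by
  obtain ⟨X1, ⟨A1, hr1, hX1⟩, hmin⟩ := exists_min
    (P := fun X => ∃ A', A ~r A' ∧ eval g (wordInv g X ++ A' ++ X) = u) (by
      obtain ⟨c, hc⟩ := isConj_iff.1 hu
      obtain ⟨X, hX⟩ := eval_surj c
      refine ⟨X, A, List.IsRotated.refl _, ?_⟩
      rw [eval_append, eval_append, eval_wordInv, hX, ← hc]; group) List.length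
  obtain ⟨X, hX, hirr⟩ := exists_irr (eval g X1)
  have hlen : X.length ≤ X1.length := irr_geo hirr _ hX.symm
  have hXu : eval g (wordInv g X ++ A1 ++ X) = u := by
    rw [← hX1]; simp only [eval_append, eval_wordInv, hX]
  refine ⟨X, A1, hr1, hirr, hXu, ?_⟩
  have redX := (irr_geo hirr).isReduced
  have redX' := (irr_geo hirr).inv.isReduced
  have redA := (irr_geo (hA A1 hr1)).isReduced
  have hmin' : ∀ X' A', A ~r A' → eval g (wordInv g X' ++ A' ++ X') = u →
      X.length ≤ X'.length := fun X' A' h1 h2 => hlen.trans (hmin X' ⟨A', h1, h2⟩)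
  rw [freelyReduced_iff]
  cases X with
  | nil => simpa [wordInv] using redA
  | cons x X' =>
    have hw : wordInv g (x :: X') = wordInv g X' ++ [invLetter g x] := by simp [wordInv]
    have hx : eval g [invLetter g x] = (eval g [x])⁻¹ := by
      rw [← eval_wordInv]; rfl
    have hcx : eval g (x :: X') = eval g [x] * eval g X' := by
      rw [← eval_append]; rfl
    have hA1 : A1 ≠ [] := by
      rintro rfl
      have := hmin' [] [] hr1 (by
        rw [← hXu]; simp only [eval_append, eval_wordInv, eval_nil]; group)
      simp at this
    have j1 : ∀ a A'', A1 = a :: A'' → a ≠ x := by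
      rintro a A'' rfl rfl
      have := hmin' X' (A'' ++ [a]) (hr1.trans (List.isRotated_append (l := [a]))) (by
        rw [← hXu]
        have : a :: A'' = [a] ++ A'' := rfl
        rw [this]
        simp only [eval_append, eval_wordInv, hcx]; group)
      simp at this
    have j2 : ∀ A'' b, A1 = A'' ++ [b] → x ≠ invLetter g b := by
      rintro A'' b rfl rfl
      have hb : eval g [invLetter g b] = (eval g [b])⁻¹ := by
        rw [← eval_wordInv]; rfl
      have := hmin' X' ([b] ++ A'') (hr1.trans List.isRotated_append) (by
        rw [← hXu]
        simp only [eval_append, eval_wordInv, hcx, hb]; group)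
      simp at this
    unfold FreeGroup.IsReduced at *
    rw [List.isChain_append, List.isChain_append]
    refine ⟨⟨redX', redA, ?_⟩, redX, ?_⟩
    · intro p hp q hq
      rw [hw] at hp
      obtain ⟨a, A'', rfl⟩ := List.exists_cons_of_ne_nil hA1
      simp at hp hq
      subst hp hq
      rw [red_pair, inv_inv]
      exact j1 _ _ rfl
    · intro p hp q hq
      rcases List.eq_nil_or_concat A1 with rfl | ⟨A'', b, rfl⟩
      · exact absurd rfl hA1
      rw [List.concat_eq_append] at *
      rw [← List.append_assoc] at hp
      simp at hp hq
      subst hp hq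
      rw [red_pair]
      exact j2 _ _ rfl

end final
end SGP

/-- Conjugate elements `u, v` of the surface group can be written as
`u = X⁻¹A₂A₁X`, `v = Y⁻¹A₁A₂Y` with `X, Y` irreducible, `A₁A₂` and `A₂A₁`
cyclically irreducible, and both words freely reduced. -/
theorem surface_group_conjugate_freely_reduced_presentation (g : ℕ) (hg : 2 ≤ g)
    (u v : SG.SurfaceGroup g)
    (h : ∃ x : SG.SurfaceGroup g, x⁻¹ * u * x = v) :
    ∃ X Y A₁ A₂ : SG.Word g,
      SG.IrreducibleWord g X ∧ SG.IrreducibleWord g Y ∧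
      SG.CyclicallyIrreducibleWord g (A₁ ++ A₂) ∧
      SG.CyclicallyIrreducibleWord g (A₂ ++ A₁) ∧
      SG.eval g (SG.wordInv g X ++ A₂ ++ A₁ ++ X) = u ∧
      SG.eval g (SG.wordInv g Y ++ A₁ ++ A₂ ++ Y) = v ∧
      SG.FreelyReduced g (SG.wordInv g X ++ A₂ ++ A₁ ++ X) ∧
      SG.FreelyReduced g (SG.wordInv g Y ++ A₁ ++ A₂ ++ Y) := by
  obtain ⟨x, hx⟩ := h
  obtain ⟨A, hA, hc⟩ := SGP.exists_cyc hg u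
  have hv : IsConj v (SG.eval g A) := by
    refine IsConj.trans ?_ hA
    rw [isConj_iff]
    exact ⟨x, by rw [← hx]; group⟩
  obtain ⟨X, A', r1, i1, e1, f1⟩ := SGP.exists_form hA hc
  obtain ⟨Y, A'', r2, i2, e2, f2⟩ := SGP.exists_form hv hc
  obtain ⟨A₂, A₁, rfl, rfl⟩ := SGP.rot_split (r1.symm.trans r2)
  refine ⟨X, Y, A₁, A₂, i1, i2, fun W' e => hc W' (r2.trans e), fun W' e => hc W' (r1.trans e),
    ?_, ?_, ?_, ?_⟩
  · simpa using e1
  · simpa using e2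
  · simpa using f1
  · simpa using f2
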